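/- arXiv:0908.2543 — 5 statements merged into one kernel-verified Lean document; each statement's English description precedes it below -/
import Mathlib

section
/- For every real ε > 0 there exists an integer K such that for every integer k ≥ K and every finite k-regular simple graph G, the list dynamic chromatic number satisfies χ_d(G) ≤ ch_d(G) ≤ ⌈(1+ε)·χ_l(G)⌉, where χ_l(G) is the list chromatic number of G. -/
open SimpleGraph Set

def IsDynamicColoring {V : Type*} (G : SimpleGraph V) {n : ℕ} (c : V → Fin n) : Prop :=
  (∀ ⦃u v⦄, G.Adj u v → c u ≠ c v) ∧
  ∀ v : V, 2 ≤ (G.neighborSet v).ncard →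
    ∃ u w, u ∈ G.neighborSet v ∧ w ∈ G.neighborSet v ∧ c u ≠ c w

def DynColorable {V : Type*} (G : SimpleGraph V) (n : ℕ) : Prop :=
  ∃ c : V → Fin n, IsDynamicColoring G c

noncomputable def dynChromNum {V : Type*} (G : SimpleGraph V) : ℕ :=
  sInf {n | DynColorable G n}

noncomputable def chromNum {V : Type*} (G : SimpleGraph V) : ℕ :=
  sInf {n | G.Colorable n}

/-- `G` is `k`-regular: every vertex has exactly `k` neighbors. -/
def IsKRegular {V : Type*} (G : SimpleGraph V) (k : ℕ) : Prop :=
  ∀ v : V, (G.neighborSet v).ncard = k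


/-- `G` is `l`-list-colorable: every assignment of lists of size `l` admits a proper coloring
from the lists. -/
def ListColorable {V : Type*} (G : SimpleGraph V) (l : ℕ) : Prop :=
  ∀ L : V → Finset ℕ, (∀ v, (L v).card = l) →
    ∃ c : V → ℕ, (∀ v, c v ∈ L v) ∧ ∀ ⦃u v⦄, G.Adj u v → c u ≠ c v

/-- The list chromatic number of `G`. -/
noncomputable def listChromNum {V : Type*} (G : SimpleGraph V) : ℕ :=
  sInf {l | ListColorable G l}

/-- `G` is dynamically `l`-list-colorable: every assignment of lists of size `l` admits a
proper coloring from the lists in which every vertex of degree at least 2 sees at least two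
colors in its neighborhood. -/
def DynListColorable {V : Type*} (G : SimpleGraph V) (l : ℕ) : Prop :=
  ∀ L : V → Finset ℕ, (∀ v, (L v).card = l) →
    ∃ c : V → ℕ, (∀ v, c v ∈ L v) ∧ (∀ ⦃u v⦄, G.Adj u v → c u ≠ c v) ∧
      ∀ v : V, 2 ≤ (G.neighborSet v).ncard →
        ∃ u w, u ∈ G.neighborSet v ∧ w ∈ G.neighborSet v ∧ c u ≠ c w

/-- The list dynamic chromatic number of `G`. -/
noncomputable def listDynChromNum {V : Type*} (G : SimpleGraph V) : ℕ :=
  sInf {l | DynListColorable G l}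

/-- Greedy colouring: a graph of maximum degree at most `k` is `(k + 1)`-list-colorable. -/
theorem listColorable_succ_of_degree_le {V : Type*} [Fintype V] [DecidableEq V]
    (G : SimpleGraph V) [DecidableRel G.Adj] {k : ℕ} (hk : ∀ v, (G.neighborFinset v).card ≤ k) :
    ListColorable G (k + 1) := by
  intro L hL
  have key : ∀ S : Finset V, ∃ c : V → ℕ, (∀ v ∈ S, c v ∈ L v) ∧
      ∀ u ∈ S, ∀ v ∈ S, G.Adj u v → c u ≠ c v := by
    intro S
    induction S using Finset.induction_on with
    | empty => exact ⟨fun _ => 0, by simp, by simp⟩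
    | insert a S ha ih =>
      obtain ⟨c, hc, hproper⟩ := ih
      obtain ⟨x, hx, hx'⟩ : ∃ x ∈ L a, x ∉ (G.neighborFinset a).image c := by
        apply Finset.exists_mem_notMem_of_card_lt_card
        rw [hL a]
        exact Nat.lt_succ_of_le (Finset.card_image_le.trans (hk a))
      have hfresh : ∀ w, G.Adj a w → c w ≠ x := fun w hw h =>
        hx' (Finset.mem_image.2 ⟨w, (G.mem_neighborFinset a w).2 hw, h⟩)
      have hne : ∀ v ∈ S, v ≠ a := fun v hv h => ha (h ▸ hv)
      refine ⟨Function.update c a x, ?_, ?_⟩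
      · intro v hv
        rcases Finset.mem_insert.1 hv with rfl | hv
        · simpa using hx
        · rw [Function.update_of_ne (hne v hv)]
          exact hc v hv
      · intro u hu v hv huv
        rcases Finset.mem_insert.1 hu with hu' | hu' <;>
          rcases Finset.mem_insert.1 hv with hv' | hv'
        · exact absurd (hu'.trans hv'.symm) huv.ne
        · rw [hu'] at huv ⊢
          rw [Function.update_self, Function.update_of_ne (hne v hv')]
          exact (hfresh v huv).symm
        · rw [hv'] at huv ⊢
          rw [Function.update_self, Function.update_of_ne (hne u hu')]
          exact hfresh u huv.symm
        · rw [Function.update_of_ne (hne u hu'), Function.update_of_ne (hne v hv')]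
          exact hproper u hu' v hv' huv
  obtain ⟨c, hc, hproper⟩ := key Finset.univ
  exact ⟨c, fun v => hc v (Finset.mem_univ v),
    fun u v h => hproper u (Finset.mem_univ u) v (Finset.mem_univ v) h⟩

theorem DynListColorable.dynColorable {V : Type*} {G : SimpleGraph V} {n : ℕ}
    (h : DynListColorable G n) : DynColorable G n := by
  obtain ⟨c, hc, hproper, hdyn⟩ := h (fun _ => Finset.range n) (by simp)
  refine ⟨fun v => ⟨c v, Finset.mem_range.1 (hc v)⟩, ?_, ?_⟩
  · intro u v huv h
    exact hproper huv (Fin.ext_iff.1 h)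
  · intro v hv
    obtain ⟨u, w, hu, hw, hne⟩ := hdyn v hv
    exact ⟨u, w, hu, hw, fun h => hne (Fin.ext_iff.1 h)⟩

theorem Finset.card_filter_mem_powersetCard_mul_le {α : Type*} [DecidableEq α] (s : Finset α)
    (x : α) (l : ℕ) :
    ((s.powersetCard l).filter (x ∈ ·)).card * s.card ≤ (s.powersetCard l).card * l := by
  by_cases hx : x ∈ s
  swap
  · rw [Finset.filter_false_of_mem
      fun t ht hxt => hx ((Finset.mem_powersetCard.1 ht).1 hxt)]
    simp
  rcases l with _ | l
  · simp
  have hcard : ((s.powersetCard (l + 1)).filter (x ∈ ·)).card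
      ≤ ((s.erase x).powersetCard l).card := by
    refine Finset.card_le_card_of_injOn (·.erase x) ?_ ?_
    · intro t ht
      simp only [Finset.coe_filter, Finset.mem_powersetCard, Set.mem_ofPred_eq] at ht
      simp only [Finset.mem_coe, Finset.mem_powersetCard]
      exact ⟨Finset.erase_subset_erase x ht.1.1, by rw [Finset.card_erase_of_mem ht.2, ht.1.2]; rfl⟩
    · intro t ht t' ht' h
      simp only [Finset.coe_filter, Set.mem_ofPred_eq] at ht ht'
      rw [← Finset.insert_erase ht.2, ← Finset.insert_erase ht'.2]
      exact congrArg (insert x) h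
  obtain ⟨m, hm⟩ : ∃ m, s.card = m + 1 :=
    ⟨s.card - 1, by have := Finset.card_pos.2 ⟨x, hx⟩; omega⟩
  rw [Finset.card_powersetCard, Finset.card_erase_of_mem hx, hm, Nat.add_sub_cancel] at hcard
  rw [Finset.card_powersetCard, hm, ← Nat.add_one_mul_choose_eq, mul_comm]
  exact Nat.mul_le_mul_left _ hcard

open Classical in
/-- The assignments that choose an option from `A v` at the vertices `v` of `S` and `∅` elsewhere,
such that no colour is common to all options chosen in a neighborhood. -/
noncomputable def goodAssignments {V : Type*} [Fintype V] (G : SimpleGraph V)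
    (A : V → Finset (Finset ℕ)) (S : Finset V) : Finset (V → Finset ℕ) :=
  (Fintype.piFinset fun v => if v ∈ S then A v else {∅}).filter
    fun f => ∀ v x, ∃ u, G.Adj v u ∧ x ∉ f u

section Counting

variable {V : Type*} [Fintype V] {G : SimpleGraph V} {A : V → Finset (Finset ℕ)}

theorem mem_goodAssignments {S : Finset V} {f : V → Finset ℕ} :
    f ∈ goodAssignments G A S ↔ (∀ v ∈ S, f v ∈ A v) ∧ (∀ v ∉ S, f v = ∅) ∧
      ∀ v x, ∃ u, G.Adj v u ∧ x ∉ f u := by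
  classical
  simp only [goodAssignments, Finset.mem_filter, Fintype.mem_piFinset, ← and_assoc]
  refine and_congr_left fun _ => ⟨fun h => ⟨fun v hv => ?_, fun v hv => ?_⟩, fun h v => ?_⟩
  · simpa [hv] using h v
  · simpa [hv] using h v
  · by_cases hv : v ∈ S
    · simpa [hv] using h.1 v hv
    · simpa [hv] using h.2 v hv

variable [DecidableEq V] {q : ℝ}

theorem card_filter_goodAssignments_insert_le
    (hq : ∀ v x, (((A v).filter (x ∈ ·)).card : ℝ) ≤ q) {S T : Finset V} {w : V} (hwS : w ∈ S)
    (hwT : w ∉ T) (x : ℕ) :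
    (((goodAssignments G A S).filter fun f => ∀ t ∈ insert w T, x ∈ f t).card : ℝ) ≤
      q * ((goodAssignments G A (S.erase w)).filter fun f => ∀ t ∈ T, x ∈ f t).card := by
  have h : ((goodAssignments G A S).filter fun f => ∀ t ∈ insert w T, x ∈ f t).card ≤
      (((A w).filter (x ∈ ·)) ×ˢ
        ((goodAssignments G A (S.erase w)).filter fun f => ∀ t ∈ T, x ∈ f t)).card := by
    refine Finset.card_le_card_of_injOn (fun f => (f w, Function.update f w ∅)) ?_ ?_
    · intro f hf
      obtain ⟨hf, hx⟩ := Finset.mem_filter.1 (Finset.mem_coe.1 hf)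
      have hupd : ∀ v, v ≠ w → Function.update f w ∅ v = f v := fun v hv =>
        Function.update_of_ne hv _ _
      obtain ⟨hfS, hf0, hgood⟩ := mem_goodAssignments.1 hf
      refine Finset.mem_coe.2 (Finset.mem_product.2 ⟨Finset.mem_filter.2
        ⟨hfS w hwS, hx w (Finset.mem_insert_self w T)⟩, Finset.mem_filter.2
        ⟨mem_goodAssignments.2 ⟨?_, ?_, ?_⟩, ?_⟩⟩)
      · intro v hv
        simpa [hupd v (Finset.ne_of_mem_erase hv)] using hfS v (Finset.mem_of_mem_erase hv)
      · intro v hv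
        by_cases hvw : v = w
        · simp [hvw]
        · exact (hupd v hvw).trans (hf0 v fun hvS => hv (Finset.mem_erase.2 ⟨hvw, hvS⟩))
      · intro v y
        obtain ⟨u, hu, hy⟩ := hgood v y
        refine ⟨u, hu, ?_⟩
        by_cases huw : u = w
        · simp [huw]
        · simpa [hupd u huw] using hy
      · intro t ht
        have htw : t ≠ w := fun h => hwT (h ▸ ht)
        simpa [hupd t htw] using hx t (Finset.mem_insert_of_mem ht)
    · intro f _ g _ hfg
      obtain ⟨h1, h2⟩ := Prod.mk.inj hfg
      funext v
      by_cases hvw : v = w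
      · rw [hvw]
        exact h1
      · simpa [hvw] using congrFun h2 v
  rw [Finset.card_product] at h
  calc _ ≤ _ := Nat.cast_le.2 h
    _ = _ := Nat.cast_mul _ _
    _ ≤ _ := mul_le_mul_of_nonneg_right (hq w x) (Nat.cast_nonneg _)

theorem card_filter_goodAssignments_mul_pow_le
    (hq : ∀ v x, (((A v).filter (x ∈ ·)).card : ℝ) ≤ q) (hq0 : 0 ≤ q) {β : ℝ} (hβ : 0 ≤ β)
    (x : ℕ) (T : Finset V) : ∀ S : Finset V,
    (∀ R : Finset V, R.card < S.card → ∀ w ∉ R,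
      β * (goodAssignments G A R).card ≤ (goodAssignments G A (insert w R)).card) →
    (((goodAssignments G A S).filter fun f => ∀ t ∈ T, x ∈ f t).card : ℝ) * β ^ T.card ≤
      q ^ T.card * (goodAssignments G A S).card := by
  induction T using Finset.induction_on with
  | empty => intro S _; simp
  | insert w T hw ih =>
    intro S hS
    by_cases hwS : w ∈ S
    · have hlt : (S.erase w).card < S.card := Finset.card_erase_lt_of_mem hwS
      have h1 := card_filter_goodAssignments_insert_le (G := G) hq hwS hw x
      have h2 := ih (S.erase w) fun R hR => hS R (hR.trans hlt)
      have h3 := hS (S.erase w) hlt w (Finset.notMem_erase w S)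
      rw [Finset.insert_erase hwS] at h3
      rw [Finset.card_insert_of_notMem hw]
      calc _ ≤ q * ((goodAssignments G A (S.erase w)).filter fun f => ∀ t ∈ T, x ∈ f t).card
              * β ^ (T.card + 1) := mul_le_mul_of_nonneg_right h1 (by positivity)
        _ = q * β * (((goodAssignments G A (S.erase w)).filter fun f => ∀ t ∈ T, x ∈ f t).card
              * β ^ T.card) := by ring
        _ ≤ q * β * (q ^ T.card * (goodAssignments G A (S.erase w)).card) :=
            mul_le_mul_of_nonneg_left h2 (by positivity)
        _ = q ^ (T.card + 1) * (β * (goodAssignments G A (S.erase w)).card) := by ring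
        _ ≤ _ := mul_le_mul_of_nonneg_left h3 (by positivity)
    · rw [Finset.filter_false_of_mem]
      · simp only [Finset.card_empty, Nat.cast_zero, zero_mul]
        positivity
      · intro f hf h
        have := h w (Finset.mem_insert_self w T)
        rw [(mem_goodAssignments.1 hf).2.1 w hwS] at this
        simp at this

/-- The extensions of a good assignment by an arbitrary option at a new vertex `u` are either good
or have a neighborhood, containing `u`, with a common colour. -/
theorem card_goodAssignments_mul_card_le [DecidableRel G.Adj] {L : V → Finset ℕ}
    (hA : ∀ v, ∀ t ∈ A v, t ⊆ L v) {S : Finset V} {u : V} (hu : u ∉ S) :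
    (goodAssignments G A S).card * (A u).card ≤ (goodAssignments G A (insert u S)).card +
      ∑ v ∈ G.neighborFinset u, ∑ x ∈ L u,
        ((goodAssignments G A S).filter fun f => ∀ t ∈ (G.neighborFinset v).erase u, x ∈ f t).card
          * ((A u).filter (x ∈ ·)).card := by
  let P : V → ℕ → Finset ((V → Finset ℕ) × Finset ℕ) := fun v x =>
    ((goodAssignments G A S).filter fun f => ∀ t ∈ (G.neighborFinset v).erase u, x ∈ f t)
      ×ˢ ((A u).filter (x ∈ ·))
  let extend : (V → Finset ℕ) × Finset ℕ → (V → Finset ℕ) := fun p => Function.update p.1 u p.2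
  let E := (goodAssignments G A S) ×ˢ (A u)
  have hgood : (E.filter fun p => extend p ∈ goodAssignments G A (insert u S)).card ≤
      (goodAssignments G A (insert u S)).card := by
    refine Finset.card_le_card_of_injOn extend (fun p hp => (Finset.mem_filter.1 hp).2) ?_
    intro p hp p' hp' h
    have hz : ∀ r ∈ E, r.1 u = ∅ := fun r hr =>
      (mem_goodAssignments.1 (Finset.mem_product.1 hr).1).2.1 u hu
    have h0 := hz p (Finset.mem_filter.1 hp).1
    have h0' := hz p' (Finset.mem_filter.1 hp').1
    refine Prod.ext (funext fun v => ?_) ?_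
    · by_cases hv : v = u
      · rw [hv, h0, h0']
      · simpa [extend, hv] using congrFun h v
    · simpa [extend] using congrFun h u
  have hbad : (E.filter fun p => extend p ∉ goodAssignments G A (insert u S)) ⊆
      (G.neighborFinset u).biUnion fun v => (L u).biUnion fun x => P v x := by
    intro p hp
    obtain ⟨hpE, hp⟩ := Finset.mem_filter.1 hp
    obtain ⟨hp1, hp2⟩ := Finset.mem_product.1 hpE
    obtain ⟨hS, h0, hg⟩ := mem_goodAssignments.1 hp1
    obtain ⟨v, x, hx⟩ : ∃ v x, ∀ w, G.Adj v w → x ∈ extend p w := by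
      by_contra! hcon
      refine hp (mem_goodAssignments.2 ⟨fun v hv => ?_, fun v hv => ?_, hcon⟩)
      · by_cases hvu : v = u
        · subst hvu
          simpa [extend] using hp2
        · simpa [extend, hvu] using hS v (Finset.mem_of_mem_insert_of_ne hv hvu)
      · have hv' := not_or.1 (fun h => hv (Finset.mem_insert.2 h))
        simpa [extend, hv'.1] using h0 v hv'.2
    have hne : ∀ w, G.Adj v w → w ≠ u → x ∈ p.1 w := fun w hw hwu => by
      simpa [extend, hwu] using hx w hw
    have hvu : G.Adj v u := by
      by_contra hvu
      obtain ⟨w, hw, hxw⟩ := hg v x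
      exact hxw (hne w hw fun h => hvu (h ▸ hw))
    have hxu : x ∈ p.2 := by simpa [extend] using hx u hvu
    refine Finset.mem_biUnion.2 ⟨v, (G.mem_neighborFinset u v).2 hvu.symm,
      Finset.mem_biUnion.2 ⟨x, hA u _ hp2 hxu, Finset.mem_product.2
        ⟨Finset.mem_filter.2 ⟨hp1, fun w hw => ?_⟩, Finset.mem_filter.2 ⟨hp2, hxu⟩⟩⟩⟩
    obtain ⟨hwu, hw⟩ := Finset.mem_erase.1 hw
    exact hne w ((G.mem_neighborFinset v w).1 hw) hwu
  calc (goodAssignments G A S).card * (A u).card = E.card := (Finset.card_product _ _).symm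
    _ = _ := (Finset.card_filter_add_card_filter_not
      fun p => extend p ∈ goodAssignments G A (insert u S)).symm
    _ ≤ _ := add_le_add hgood ((Finset.card_le_card hbad).trans ?_)
  refine Finset.card_biUnion_le.trans (Finset.sum_le_sum fun v _ => ?_)
  refine Finset.card_biUnion_le.trans (Finset.sum_le_sum fun x _ => ?_)
  exact (Finset.card_product _ _).le

theorem mul_card_goodAssignments_le [DecidableRel G.Adj] {L : V → Finset ℕ} {k m N : ℕ}
    (hG : ∀ v, (G.neighborFinset v).card = k + 1) (hL : ∀ v, (L v).card = m)
    (hA : ∀ v, ∀ t ∈ A v, t ⊆ L v) (hN : ∀ v, (A v).card = N)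
    (hq : ∀ v x, (((A v).filter (x ∈ ·)).card : ℝ) ≤ q) (hq0 : 0 ≤ q) {β : ℝ} (hβ : 0 < β)
    (hbound : (k + 1) * m * q * (q / β) ^ k ≤ N - β) :
    ∀ (n : ℕ) (S : Finset V), S.card = n → ∀ u ∉ S,
      β * (goodAssignments G A S).card ≤ (goodAssignments G A (insert u S)).card := by
  intro n
  induction n using Nat.strong_induction_on with
  | _ n ih =>
    intro S hS u hu
    set C : ℝ := ((goodAssignments G A S).card : ℝ)
    have hC : 0 ≤ C := Nat.cast_nonneg _
    have hterm : ∀ v ∈ G.neighborFinset u, ∀ x ∈ L u,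
        (((goodAssignments G A S).filter
          fun f => ∀ t ∈ (G.neighborFinset v).erase u, x ∈ f t).card : ℝ)
          * ((A u).filter (x ∈ ·)).card ≤ q * (q / β) ^ k * C := by
      intro v hv x _
      have hcard : ((G.neighborFinset v).erase u).card = k := by
        rw [Finset.card_erase_of_mem, hG v, Nat.add_sub_cancel]
        exact (G.mem_neighborFinset v u).2 ((G.mem_neighborFinset u v).1 hv).symm
      have h := card_filter_goodAssignments_mul_pow_le (G := G) hq hq0 hβ.le x
        ((G.neighborFinset v).erase u) S fun R hR => ih R.card (hS ▸ hR) R rfl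
      rw [hcard, ← le_div_iff₀ (by positivity)] at h
      calc _ ≤ q ^ k * C / β ^ k * q :=
            mul_le_mul h (hq u x) (Nat.cast_nonneg _) (by positivity)
        _ = _ := by rw [div_pow]; ring
    have hsum := card_goodAssignments_mul_card_le (G := G) hA hu
    rw [← Nat.cast_le (α := ℝ)] at hsum
    push_cast at hsum
    have hle := Finset.sum_le_sum fun v hv => Finset.sum_le_sum (hterm v hv)
    simp only [Finset.sum_const, nsmul_eq_mul, hG, hL] at hle
    rw [hN] at hsum
    push_cast at hle
    have := mul_le_mul_of_nonneg_right hbound hC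
    linarith

/-- If every option avoids each colour often enough, options can be chosen so that no colour is
common to all options in a neighborhood. -/
theorem exists_choice_no_common_color [DecidableRel G.Adj] {L : V → Finset ℕ} {k m N : ℕ}
    (hG : ∀ v, (G.neighborFinset v).card = k + 1) (hL : ∀ v, (L v).card = m)
    (hA : ∀ v, ∀ t ∈ A v, t ⊆ L v) (hN : ∀ v, (A v).card = N)
    (hq : ∀ v x, (((A v).filter (x ∈ ·)).card : ℝ) ≤ q) (hq0 : 0 ≤ q) {β : ℝ} (hβ : 0 < β)
    (hbound : (k + 1) * m * q * (q / β) ^ k ≤ N - β) :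
    ∃ f : V → Finset ℕ, (∀ v, f v ∈ A v) ∧ ∀ v x, ∃ u, G.Adj v u ∧ x ∉ f u := by
  have hpos : ∀ S : Finset V, (goodAssignments G A S).Nonempty := by
    intro S
    induction S using Finset.induction_on with
    | empty =>
      refine ⟨fun _ => ∅, mem_goodAssignments.2 ⟨by simp, by simp, fun v x => ?_⟩⟩
      obtain ⟨u, hu⟩ := Finset.card_pos.1 (by rw [hG v]; omega : 0 < (G.neighborFinset v).card)
      exact ⟨u, (G.mem_neighborFinset v u).1 hu, by simp⟩
    | insert u S hu ih =>
      have h := mul_card_goodAssignments_le hG hL hA hN hq hq0 hβ hbound S.card S rfl u hu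
      have : (0 : ℝ) < (goodAssignments G A S).card := Nat.cast_pos.2 ih.card_pos
      exact Finset.card_pos.1 (Nat.cast_pos.1 ((mul_pos hβ this).trans_le h))
  obtain ⟨f, hf⟩ := hpos Finset.univ
  obtain ⟨h1, -, h2⟩ := mem_goodAssignments.1 hf
  exact ⟨f, fun v => h1 v (Finset.mem_univ v), h2⟩

end Counting

/-- Passing to sublists of size `l` turns list colorings into dynamic ones, if the lists are longer
than `l` by a factor `ρ⁻¹` and not too long in terms of the degree. -/
theorem ListColorable.dynListColorable {V : Type*} [Fintype V] [DecidableEq V]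
    {G : SimpleGraph V} [DecidableRel G.Adj] {k l m : ℕ} {ρ η : ℝ} (h : ListColorable G l)
    (hG : ∀ v, (G.neighborFinset v).card = k + 1) (hm : 0 < m) (hρ : 0 ≤ ρ) (hη : 0 < η)
    (hρη : ρ ≤ 1) (hl : (l : ℝ) ≤ ρ * m)
    (hbound : (k + 1) * m * ρ * (ρ / η) ^ k ≤ 1 - η) : DynListColorable G m := by
  intro L hL
  have hlm : l ≤ m := by
    have : (l : ℝ) ≤ m := hl.trans (mul_le_of_le_one_left (Nat.cast_nonneg m) hρη)
    exact_mod_cast this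
  have hN : (0 : ℝ) < m.choose l := Nat.cast_pos.2 (Nat.choose_pos hlm)
  have hq : ∀ v x,
      ((((L v).powersetCard l).filter (x ∈ ·)).card : ℝ) ≤ ρ * m.choose l := by
    intro v x
    have hcount := Finset.card_filter_mem_powersetCard_mul_le (L v) x l
    rw [Finset.card_powersetCard, hL, ← Nat.cast_le (α := ℝ)] at hcount
    push_cast at hcount
    refine le_of_mul_le_mul_right (hcount.trans ?_) (Nat.cast_pos.2 hm)
    calc _ ≤ (m.choose l : ℝ) * (ρ * m) := mul_le_mul_of_nonneg_left hl hN.le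
      _ = _ := by ring
  have hβ : (k + 1) * m * (ρ * m.choose l) * (ρ * m.choose l / (η * m.choose l)) ^ k ≤
      m.choose l - η * m.choose l := by
    rw [mul_div_mul_right _ _ hN.ne']
    calc _ = (k + 1) * m * ρ * (ρ / η) ^ k * m.choose l := by ring
      _ ≤ (1 - η) * m.choose l := mul_le_mul_of_nonneg_right hbound hN.le
      _ = _ := by ring
  obtain ⟨f, hf, hcommon⟩ := exists_choice_no_common_color (G := G)
    (A := fun v => (L v).powersetCard l) (L := L) (k := k) (m := m) (N := m.choose l)
    (q := ρ * m.choose l) (β := η * m.choose l) hG hL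
    (fun v t ht => (Finset.mem_powersetCard.1 ht).1)
    (fun v => by rw [Finset.card_powersetCard, hL]) hq (by positivity) (by positivity) hβ
  obtain ⟨c, hc, hproper⟩ := h f fun v => (Finset.mem_powersetCard.1 (hf v)).2
  refine ⟨c, fun v => (Finset.mem_powersetCard.1 (hf v)).1 (hc v), hproper, fun v _ => ?_⟩
  obtain ⟨u, hu⟩ := Finset.card_pos.1 (by rw [hG v]; omega : 0 < (G.neighborFinset v).card)
  obtain ⟨w, hw, hne⟩ := hcommon v (c u)
  exact ⟨u, w, (G.mem_neighborFinset v u).1 hu, hw, fun h => hne (h ▸ hc w)⟩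

/-- For a ratio `θ < 1`, exponential decay in the degree beats a quadratic factor. -/
theorem eventually_mul_sq_mul_pow_le {θ a b : ℝ} (hθ0 : 0 ≤ θ) (hθ : θ < 1) (hb : 0 < b) :
    ∀ᶠ k : ℕ in Filter.atTop, a * ((k : ℝ) + 2) ^ 2 * θ ^ k ≤ b := by
  have h0 := tendsto_pow_const_mul_const_pow_of_abs_lt_one 0 (abs_lt.2 ⟨by linarith, hθ⟩)
  have h1 := tendsto_pow_const_mul_const_pow_of_abs_lt_one 1 (abs_lt.2 ⟨by linarith, hθ⟩)
  have h2 := tendsto_pow_const_mul_const_pow_of_abs_lt_one 2 (abs_lt.2 ⟨by linarith, hθ⟩)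
  have h := ((h2.add (h1.const_mul 4)).add (h0.const_mul 4)).const_mul a
  simp only [mul_zero, add_zero] at h
  filter_upwards [h.eventually_le_const hb] with k hk
  refine le_of_eq_of_le ?_ hk
  ring

/-- For every `ε > 0` there is `K` such that for every `k ≥ K`, every finite `k`-regular
graph `G` satisfies `χ_d(G) ≤ ch_d(G) ≤ ⌈(1+ε) χ_l(G)⌉`. -/
theorem listDynChromNum_le (ε : ℝ) (hε : 0 < ε) :
    ∃ K : ℕ, ∀ (k : ℕ), K ≤ k → ∀ (V : Type) [Fintype V] (G : SimpleGraph V),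
      IsKRegular G k →
        dynChromNum G ≤ listDynChromNum G ∧
        (listDynChromNum G : ℝ) ≤ ⌈(1 + ε) * (listChromNum G : ℝ)⌉ := by
  classical
  set ρ : ℝ := 1 / (1 + ε) with hρdef
  set η : ℝ := (1 + ρ) / 2 with hηdef
  have hρ0 : 0 < ρ := by positivity
  have hρ1 : ρ < 1 := by
    rw [hρdef, div_lt_one (by linarith)]
    linarith
  have hη0 : 0 < η := by positivity
  have hη1 : η < 1 := by linarith
  have hθ : ρ / η < 1 := by
    rw [div_lt_one hη0]
    linarith
  obtain ⟨K, hK⟩ := Filter.eventually_atTop.1 (eventually_mul_sq_mul_pow_le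
    (a := (2 + ε) * ρ) (by positivity) hθ (sub_pos.2 hη1))
  refine ⟨K + 1, fun k hk V _ G hG => ?_⟩
  obtain ⟨k, rfl⟩ : ∃ j, k = j + 1 := ⟨k - 1, by omega⟩
  have hdeg : ∀ v, (G.neighborFinset v).card = k + 1 := fun v => by
    rw [← hG v, Set.ncard_eq_toFinset_card', SimpleGraph.neighborFinset]
  have hgreedy : ListColorable G (k + 2) :=
    listColorable_succ_of_degree_le G fun v => (hdeg v).le
  have hlist : ListColorable G (listChromNum G) :=
    Nat.sInf_mem (s := {l | ListColorable G l}) ⟨_, hgreedy⟩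
  have hl : listChromNum G ≤ k + 2 := Nat.sInf_le hgreedy
  set l := listChromNum G
  have hdyn : DynListColorable G ⌈(1 + ε) * (l : ℝ)⌉₊ := by
    rcases isEmpty_or_nonempty V with hV | ⟨⟨v⟩⟩
    · exact fun L _ => ⟨fun _ => 0, fun v => isEmptyElim v, fun v => isEmptyElim v,
        fun v => isEmptyElim v⟩
    have hlpos : 0 < l := by
      rcases Nat.eq_zero_or_pos l with h0 | h0
      · rw [h0] at hlist
        obtain ⟨c, hc, -⟩ := hlist (fun _ => ∅) (by simp)
        exact absurd (hc v) (by simp)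
      · exact h0
    have hl1 : (1 : ℝ) ≤ l := Nat.one_le_cast.2 hlpos
    have hl2 : (l : ℝ) ≤ k + 2 := by exact_mod_cast hl
    have hlower := Nat.le_ceil ((1 + ε) * (l : ℝ))
    have hupper := (Nat.ceil_lt_add_one (by positivity : 0 ≤ (1 + ε) * (l : ℝ))).le
    refine hlist.dynListColorable hdeg (Nat.ceil_pos.2 (by positivity)) hρ0.le hη0 hρ1.le ?_ ?_
    · rw [hρdef, one_div, ← div_eq_inv_mul, le_div_iff₀ (by positivity), mul_comm]
      exact hlower
    · refine le_trans ?_ (hK k (by omega))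
      have hm : (⌈(1 + ε) * (l : ℝ)⌉₊ : ℝ) ≤ (2 + ε) * (k + 2) := by nlinarith
      calc ((k : ℝ) + 1) * ⌈(1 + ε) * (l : ℝ)⌉₊ * ρ * (ρ / η) ^ k
          ≤ (k + 2) * ((2 + ε) * (k + 2)) * ρ * (ρ / η) ^ k := by
            gcongr
            norm_num
        _ = _ := by ring
  refine ⟨Nat.sInf_le (DynListColorable.dynColorable 
    (Nat.sInf_mem (s := {l | DynListColorable G l}) ⟨_, hdyn⟩)), ?_⟩
  have hle : (listDynChromNum G : ℤ) ≤ ⌈(1 + ε) * (l : ℝ)⌉ := by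
    rw [← Int.natCast_ceil_eq_ceil (by positivity)]
    exact Int.ofNat_le.2 (Nat.sInf_le hdyn)
  exact_mod_cast hle
end

section
/- Let H be a finite hypergraph, given as a finite family of hyperedges, each hyperedge being a subset of a finite vertex set V. Suppose there are integers 2 ≤ r₁ ≤ r₂ such that every hyperedge f satisfies r₁ ≤ |f| ≤ r₂, and suppose e·r₂·Δ(H)·(1/2)^{r₁−1} ≤ 1, where Δ(H) is the maximum, over vertices v, of the number of hyperedges containing v, and e is Euler's number. Then H is 2-colorable: there is a function from V to {0,1} under which no hyperedge is monochromatic. -/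
open Finset

/-- The degree of a vertex `v` in a hypergraph given as a finite family `H` of hyperedges:
the number of hyperedges containing `v`. -/
def hyperDegree {V : Type*} [DecidableEq V] (H : Finset (Finset V)) (v : V) : ℕ :=
  (H.filter (fun f => v ∈ f)).card

/-- The maximum degree of a hypergraph on a finite vertex type. -/
def hyperMaxDegree {V : Type*} [DecidableEq V] [Fintype V] (H : Finset (Finset V)) : ℕ :=
  Finset.univ.sup (fun v => hyperDegree H v)

/-- A 2-coloring of the vertices under which no hyperedge of `H` is monochromatic. -/
def IsProper2Coloring {V : Type*} (H : Finset (Finset V)) (c : V → Bool) : Prop :=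
  ∀ f ∈ H, ∃ u ∈ f, ∃ w ∈ f, c u ≠ c w

/-- The outcomes lying in none of the events `A i`, `i ∈ S`. -/
def avoiding {Ω ι : Type*} [Fintype Ω] [DecidableEq Ω] (A : ι → Finset Ω) (S : Finset ι) :
    Finset Ω :=
  univ.filter fun ω => ∀ i ∈ S, ω ∉ A i

theorem card_avoiding_insert {Ω ι : Type*} [Fintype Ω] [DecidableEq Ω] [DecidableEq ι]
    (A : ι → Finset Ω) (S : Finset ι) (i : ι) :
    (avoiding A (insert i S)).card + (A i ∩ avoiding A S).card = (avoiding A S).card := by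
  rw [← card_sdiff_add_card_inter (avoiding A S) (A i), inter_comm (A i)]
  congr 2
  ext ω
  simp [avoiding, and_comm]

theorem avoiding_anti {Ω ι : Type*} [Fintype Ω] [DecidableEq Ω] (A : ι → Finset Ω)
    {S T : Finset ι} (h : S ⊆ T) : avoiding A T ⊆ avoiding A S := by
  intro ω hω
  simp only [avoiding, mem_filter, mem_univ, true_and] at hω ⊢
  exact fun i hi => hω i (h hi)

/-- The conditional probability bound in the Lovász local lemma, for the uniform measure on a
finite set of outcomes. -/
theorem card_inter_avoiding_le {Ω ι : Type*} [Fintype Ω] [DecidableEq Ω] [DecidableEq ι]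
    (A : ι → Finset Ω) (I : Finset ι) (Γ : ι → Finset ι) (d : ℕ) (p x : ℝ)
    (hx0 : 0 ≤ x) (hx1 : x < 1) (hp : p ≤ x * (1 - x) ^ d)
    (hΓ : ∀ i ∈ I, (Γ i).card ≤ d)
    (hA : ∀ i ∈ I, ∀ S ⊆ I, i ∉ S → Disjoint S (Γ i) →
      ((A i ∩ avoiding A S).card : ℝ) ≤ p * (avoiding A S).card) :
    ∀ S ⊆ I, ∀ i ∈ I, i ∉ S →
      ((A i ∩ avoiding A S).card : ℝ) ≤ x * (avoiding A S).card := by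
  intro S
  induction S using Finset.strongInductionOn with
  | _ S ih =>
  intro hS i hi hiS
  have hsub : S \ Γ i ⊆ S := sdiff_subset
  have chain : ∀ U ⊆ S ∩ Γ i, (1 - x) ^ U.card * ((avoiding A (S \ Γ i)).card : ℝ) ≤
      (avoiding A (U ∪ S \ Γ i)).card := by
    intro U
    induction U using Finset.induction_on with
    | empty => simp
    | insert a U haU ihU =>
      intro hU
      obtain ⟨ha, hU⟩ := insert_subset_iff.1 hU
      obtain ⟨haS, haΓ⟩ := mem_inter.1 ha
      have haT : a ∉ U ∪ S \ Γ i := by simp [haU, haΓ]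
      have hTS : U ∪ S \ Γ i ⊆ S := union_subset (hU.trans inter_subset_left) hsub
      have hstep := ih _ ((ssubset_iff_of_subset hTS).2 ⟨a, haS, haT⟩) (hTS.trans hS) a
        (hS haS) haT
      have hcount : ((avoiding A (insert a (U ∪ S \ Γ i))).card : ℝ) +
          (A a ∩ avoiding A (U ∪ S \ Γ i)).card = (avoiding A (U ∪ S \ Γ i)).card := by
        exact_mod_cast card_avoiding_insert A (U ∪ S \ Γ i) a
      rw [insert_union, card_insert_of_notMem haU, pow_succ']
      have := mul_le_mul_of_nonneg_left (ihU hU) (sub_nonneg.2 hx1.le)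
      linarith
  have hchain := chain _ Subset.rfl
  rw [union_comm, sdiff_union_inter] at hchain
  have hcard : (S ∩ Γ i).card ≤ d := (card_le_card inter_subset_right).trans (hΓ i hi)
  have hpow : (1 - x) ^ d ≤ (1 - x) ^ (S ∩ Γ i).card :=
    pow_le_pow_of_le_one (by linarith) (by linarith) hcard
  calc ((A i ∩ avoiding A S).card : ℝ)
      ≤ (A i ∩ avoiding A (S \ Γ i)).card := by
        exact_mod_cast card_le_card (inter_subset_inter_left (avoiding_anti A hsub))
    _ ≤ p * (avoiding A (S \ Γ i)).card :=
        hA i hi _ (hsub.trans hS) (fun h => hiS (hsub h)) sdiff_disjoint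
    _ ≤ x * (1 - x) ^ (S ∩ Γ i).card * (avoiding A (S \ Γ i)).card := by
        gcongr
        exact hp.trans (by gcongr)
    _ ≤ x * (avoiding A S).card := by
        rw [mul_assoc]
        gcongr

/-- The Lovász local lemma for the uniform measure on a finite set of outcomes. -/
theorem avoiding_nonempty {Ω ι : Type*} [Fintype Ω] [Nonempty Ω] [DecidableEq Ω] [DecidableEq ι]
    (A : ι → Finset Ω) (I : Finset ι) (Γ : ι → Finset ι) (d : ℕ) (p x : ℝ)
    (hx0 : 0 ≤ x) (hx1 : x < 1) (hp : p ≤ x * (1 - x) ^ d)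
    (hΓ : ∀ i ∈ I, (Γ i).card ≤ d)
    (hA : ∀ i ∈ I, ∀ S ⊆ I, i ∉ S → Disjoint S (Γ i) →
      ((A i ∩ avoiding A S).card : ℝ) ≤ p * (avoiding A S).card) :
    (avoiding A I).Nonempty := by
  have key := card_inter_avoiding_le A I Γ d p x hx0 hx1 hp hΓ hA
  suffices ∀ S ⊆ I, (avoiding A S).Nonempty from this I Subset.rfl
  intro S
  induction S using Finset.induction_on with
  | empty => simp [avoiding]
  | insert a S haS ihS =>
    intro hS
    obtain ⟨ha, hS⟩ := insert_subset_iff.1 hS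
    have hpos : (0 : ℝ) < (avoiding A S).card := by exact_mod_cast (ihS hS).card_pos
    have hcount : ((avoiding A (insert a S)).card : ℝ) + (A a ∩ avoiding A S).card =
        (avoiding A S).card := by
      exact_mod_cast card_avoiding_insert A S a
    have hstep := key S hS a ha haS
    have : (0 : ℝ) < (avoiding A (insert a S)).card := by nlinarith
    exact card_pos.1 (by exact_mod_cast this)

/-- The 2-colorings that are constant on `f`. -/
def monochromatic {V : Type*} [DecidableEq V] [Fintype V] (f : Finset V) :
    Finset (V → Bool) :=
  univ.filter fun c => ∀ u ∈ f, ∀ w ∈ f, c u = c w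

/-- Being monochromatic on `f` is independent of the behaviour on edges disjoint from `f`. -/
theorem two_pow_mul_card_monochromatic_inter_le {V : Type*} [DecidableEq V] [Fintype V]
    (f : Finset V) (hf : f.Nonempty) (S : Finset (Finset V)) (hS : ∀ g ∈ S, Disjoint g f) :
    2 ^ f.card * (monochromatic f ∩ avoiding monochromatic S).card ≤
      2 * (avoiding monochromatic S).card := by
  obtain ⟨v, hv⟩ := hf
  let φ : (f → Bool) × (V → Bool) → Bool × (V → Bool) := fun q =>
    (q.2 v, fun u => if h : u ∈ f then q.1 ⟨u, h⟩ else q.2 u)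
  have hle : ((univ : Finset (f → Bool)) ×ˢ
      (monochromatic f ∩ avoiding monochromatic S)).card ≤
      ((univ : Finset Bool) ×ˢ avoiding monochromatic S).card := by
    apply card_le_card_of_injOn φ
    · rintro ⟨a, c⟩ hac
      simp only [coe_product, Set.mem_prod, mem_coe, mem_univ, true_and, mem_inter, avoiding,
        mem_filter, φ, monochromatic] at hac ⊢
      intro g hg hmono
      refine hac.2 g hg fun u hu w hw => ?_
      have hu' : u ∉ f := disjoint_left.1 (hS g hg) hu
      have hw' : w ∉ f := disjoint_left.1 (hS g hg) hw
      simpa [hu', hw'] using hmono u hu w hw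
    · rintro ⟨a, c⟩ hac ⟨b, c'⟩ hbc heq
      simp only [coe_product, Set.mem_prod, mem_coe, mem_univ, true_and, mem_inter,
        mem_filter, monochromatic] at hac hbc
      simp only [φ, Prod.mk.injEq] at heq
      obtain ⟨hval, hfun⟩ := heq
      refine Prod.ext (funext fun u => ?_) (funext fun u => ?_)
      · simpa using congrFun hfun u
      · by_cases hu : u ∈ f
        · exact (hac.1 u hu v hv).trans (hval.trans (hbc.1 v hv u hu))
        · simpa [hu] using congrFun hfun u
  simpa [card_product] using hle

theorem card_filter_not_disjoint_le {V : Type*} [DecidableEq V] [Fintype V]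
    (H : Finset (Finset V)) (f : Finset V) :
    (H.filter fun g => ¬ Disjoint g f).card ≤ f.card * hyperMaxDegree H := by
  have hsub : (H.filter fun g => ¬ Disjoint g f) ⊆
      f.biUnion fun v => H.filter fun g => v ∈ g := by
    intro g hg
    obtain ⟨hgH, hgf⟩ := mem_filter.1 hg
    obtain ⟨v, hvg, hvf⟩ := not_disjoint_iff.1 hgf
    exact mem_biUnion.2 ⟨v, hvf, mem_filter.2 ⟨hgH, hvg⟩⟩
  exact (card_le_card hsub).trans
    (card_biUnion_le_card_mul _ _ _ fun v _ => le_sup (f := hyperDegree H) (mem_univ v))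

theorem exp_neg_one_le_one_sub_inv_pow (d : ℕ) (hd : 1 ≤ d) :
    Real.exp (-1) ≤ (1 - 1 / ((d : ℝ) + 1)) ^ d := by
  have hd0 : (0 : ℝ) < d := by exact_mod_cast hd
  have hinv : 1 - 1 / ((d : ℝ) + 1) = (1 / (d : ℝ) + 1)⁻¹ := by
    field_simp
    ring
  rw [hinv, inv_pow, Real.exp_neg]
  gcongr
  calc (1 / (d : ℝ) + 1) ^ d ≤ Real.exp (1 / d) ^ d := by
        gcongr
        exact Real.add_one_le_exp _
    _ = Real.exp 1 := by
        rw [← Real.exp_nat_mul]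
        congr 1
        field_simp

/-- If every hyperedge `f` of `H` satisfies `r₁ ≤ |f| ≤ r₂` with `2 ≤ r₁ ≤ r₂` and
`e · r₂ · Δ(H) · (1/2)^(r₁ - 1) ≤ 1`, then `H` is 2-colorable. -/
theorem hypergraph_two_colorable {V : Type*} [DecidableEq V] [Fintype V]
    (H : Finset (Finset V)) (r₁ r₂ : ℕ) (hr₁ : 2 ≤ r₁) (hr₁₂ : r₁ ≤ r₂)
    (hcard : ∀ f ∈ H, r₁ ≤ f.card ∧ f.card ≤ r₂)
    (hineq : Real.exp 1 * (r₂ : ℝ) * (hyperMaxDegree H : ℝ) * (1 / 2 : ℝ) ^ (r₁ - 1) ≤ 1) :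
    ∃ c : V → Bool, IsProper2Coloring H c := by
  have hne : ∀ f ∈ H, f.Nonempty := fun f hf =>
    card_pos.1 (by have := (hcard f hf).1; omega)
  obtain rfl | ⟨f₀, hf₀⟩ := H.eq_empty_or_nonempty
  · exact ⟨fun _ => true, by simp [IsProper2Coloring]⟩
  have hΔ : 1 ≤ hyperMaxDegree H := by
    obtain ⟨v, hv⟩ := hne f₀ hf₀
    exact (card_pos.2 ⟨f₀, mem_filter.2 ⟨hf₀, hv⟩⟩ : 0 < hyperDegree H v).trans_le
      (le_sup (f := hyperDegree H) (mem_univ v))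
  obtain ⟨d, hd⟩ : ∃ d, r₂ * hyperMaxDegree H = d + 1 :=
    Nat.exists_eq_succ_of_ne_zero (Nat.mul_pos (by omega) hΔ).ne'
  have hd1 : 1 ≤ d := by nlinarith
  have hdR : (r₂ : ℝ) * hyperMaxDegree H = d + 1 := by exact_mod_cast hd
  have hd0 : (0 : ℝ) < d := by exact_mod_cast hd1
  have hp : (1 / 2 : ℝ) ^ (r₁ - 1) ≤ 1 / ((d : ℝ) + 1) * (1 - 1 / ((d : ℝ) + 1)) ^ d := by
    refine le_trans ?_ (mul_le_mul_of_nonneg_left (exp_neg_one_le_one_sub_inv_pow d hd1)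
      (by positivity))
    rw [mul_assoc (Real.exp 1), hdR] at hineq
    rw [Real.exp_neg, one_div ((d : ℝ) + 1), ← mul_inv, ← one_div, le_div_iff₀ (by positivity)]
    linarith
  obtain ⟨c, hc⟩ := avoiding_nonempty (monochromatic (V := V)) H
    (fun f => (H.filter fun g => ¬ Disjoint g f).erase f) d _ (1 / ((d : ℝ) + 1))
    (by positivity) (by rw [div_lt_one (by positivity)]; linarith) hp
    (fun f hf => by
      have hmem : f ∈ H.filter fun g => ¬ Disjoint g f :=
        mem_filter.2 ⟨hf, by simpa [disjoint_self_iff_empty] using (hne f hf).ne_empty⟩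
      have hle := (card_filter_not_disjoint_le H f).trans
        (Nat.mul_le_mul_right _ (hcard f hf).2)
      rw [card_erase_of_mem hmem]
      omega)
    (fun f hf S hSH hfS hdisj => by
      have hS : ∀ g ∈ S, Disjoint g f := fun g hg => by
        by_contra hgf
        exact disjoint_left.1 hdisj hg (mem_erase.2
          ⟨fun h => hfS (h ▸ hg), mem_filter.2 ⟨hSH hg, hgf⟩⟩)
      have hmono := two_pow_mul_card_monochromatic_inter_le f (hne f hf) S hS
      have hpow : 2 ^ r₁ * (monochromatic f ∩ avoiding monochromatic S).card ≤
          2 * (avoiding monochromatic S).card :=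
        (Nat.mul_le_mul_right _ (Nat.pow_le_pow_right two_pos (hcard f hf).1)).trans hmono
      obtain ⟨k, rfl⟩ : ∃ k, r₁ = k + 1 := ⟨r₁ - 1, by omega⟩
      have hpow' : 2 ^ k * (monochromatic f ∩ avoiding monochromatic S).card ≤
          (avoiding monochromatic S).card := by
        rw [pow_succ] at hpow
        linarith
      rw [Nat.add_sub_cancel, one_div, inv_pow, inv_mul_eq_div, le_div_iff₀' (by positivity)]
      exact_mod_cast hpow')
  refine ⟨c, fun f hf => ?_⟩
  simp only [avoiding, monochromatic, mem_filter, mem_univ, true_and] at hc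
  simpa using hc f hf
end

section
/- Let G be a finite simple graph with maximum degree Δ and minimum degree δ satisfying e·Δ² ≤ 2^{δ−1} (where e is Euler's number). Then χ_d(G) ≤ 2·χ(G). -/
open SimpleGraph Set

/-- The symmetric local lemma in counting form: if, for every index `i`, at most the fraction
`x * (1 - x) ^ d` of the points avoiding all the bad events of a set `S` disjoint from
`insert i (Γ i)` lie in the event `i`, and `Γ i` has at most `d` elements, then given that the
events of `S` are avoided, the event `i ∉ S` has proportion at most `x`. -/
theorem local_lemma_card_le {Ω ι : Type*} [Fintype Ω] (bad : ι → Ω → Prop) (Γ : ι → Finset ι)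
    (d : ℕ) (x : ℝ) (hx0 : 0 ≤ x) (hx1 : x ≤ 1) (hΓ : ∀ i, (Γ i).card ≤ d)
    (hindep : ∀ i (S : Finset ι), i ∉ S → Disjoint S (Γ i) →
      (Nat.card {ω // (∀ j ∈ S, ¬ bad j ω) ∧ bad i ω} : ℝ) ≤
        x * (1 - x) ^ d * Nat.card {ω // ∀ j ∈ S, ¬ bad j ω})
    (S : Finset ι) : ∀ i ∉ S,
      (Nat.card {ω // (∀ j ∈ S, ¬ bad j ω) ∧ bad i ω} : ℝ) ≤
        x * Nat.card {ω // ∀ j ∈ S, ¬ bad j ω} := by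
  classical
  induction S using Finset.strongInduction with
  | H S ih =>
    intro i hi
    set S₂ := S \ Γ i with hS₂
    have hgrow : ∀ T : Finset ι, T ⊆ S ∩ Γ i →
        (1 - x) ^ T.card * (Nat.card {ω // ∀ j ∈ S₂, ¬ bad j ω} : ℝ) ≤
          Nat.card {ω // ∀ j ∈ S₂ ∪ T, ¬ bad j ω} := by
      intro T
      induction T using Finset.induction_on with
      | empty => intro _; simp
      | insert a T ha ihT =>
        intro hT
        have haS : a ∈ S ∩ Γ i := hT (Finset.mem_insert_self _ _)
        have hTS : T ⊆ S ∩ Γ i := fun y hy => hT (Finset.mem_insert_of_mem hy)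
        have ha' : a ∉ S₂ ∪ T := by grind
        have hss : S₂ ∪ T ⊂ S := by
          refine (Finset.ssubset_iff_of_subset ?_).2 ⟨a, by grind, ha'⟩
          intro y hy
          have := @hTS y
          grind
        have h1 := ih _ hss a ha'
        have h2 := ihT hTS
        have h3 : Nat.card {ω // ∀ j ∈ S₂ ∪ T, ¬ bad j ω} =
            Nat.card {ω // (∀ j ∈ S₂ ∪ T, ¬ bad j ω) ∧ bad a ω} +
              Nat.card {ω // ∀ j ∈ S₂ ∪ insert a T, ¬ bad j ω} := by
          simp only [Nat.card_eq_fintype_card, Fintype.card_subtype]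
          rw [← Finset.card_filter_add_card_filter_not (s := Finset.univ.filter
            fun ω => ∀ j ∈ S₂ ∪ T, ¬ bad j ω) (fun ω => bad a ω), Finset.filter_filter,
            Finset.filter_filter]
          congr 2
          ext ω
          simp only [Finset.mem_filter, Finset.mem_univ, true_and, Finset.union_insert,
            Finset.forall_mem_insert]
          tauto
        have h3' : (Nat.card {ω // ∀ j ∈ S₂ ∪ T, ¬ bad j ω} : ℝ) =
            Nat.card {ω // (∀ j ∈ S₂ ∪ T, ¬ bad j ω) ∧ bad a ω} +
              Nat.card {ω // ∀ j ∈ S₂ ∪ insert a T, ¬ bad j ω} := by exact_mod_cast h3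
        rw [Finset.card_insert_of_notMem ha, pow_succ]
        have h4 := mul_le_mul_of_nonneg_left h2 (sub_nonneg.2 hx1)
        linarith
    have hcover : S₂ ∪ S ∩ Γ i = S := by rw [hS₂, Finset.sdiff_union_inter]
    have h1 := hgrow _ subset_rfl
    rw [hcover] at h1
    have hmono : (Nat.card {ω // (∀ j ∈ S, ¬ bad j ω) ∧ bad i ω} : ℝ) ≤
        Nat.card {ω // (∀ j ∈ S₂, ¬ bad j ω) ∧ bad i ω} := by
      simp only [Nat.card_eq_fintype_card, Fintype.card_subtype]
      norm_cast
      refine Finset.card_le_card fun ω hω => ?_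
      simp only [Finset.mem_filter, Finset.mem_univ, true_and] at hω ⊢
      exact ⟨fun j hj => hω.1 j (Finset.sdiff_subset hj), hω.2⟩
    have hd : (1 - x) ^ d ≤ (1 - x) ^ (S ∩ Γ i).card :=
      pow_le_pow_of_le_one (sub_nonneg.2 hx1) (by linarith)
        ((Finset.card_le_card Finset.inter_subset_right).trans (hΓ i))
    calc _ ≤ _ := hmono
      _ ≤ x * (1 - x) ^ d * Nat.card {ω // ∀ j ∈ S₂, ¬ bad j ω} :=
        hindep i S₂ (by grind) Finset.sdiff_disjoint
      _ ≤ x * ((1 - x) ^ (S ∩ Γ i).card * Nat.card {ω // ∀ j ∈ S₂, ¬ bad j ω}) := by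
        rw [mul_assoc]; gcongr
      _ ≤ _ := by gcongr

/-- The symmetric local lemma in counting form. -/
theorem exists_forall_not_bad_of_local_lemma {Ω ι : Type*} [Fintype Ω] [Nonempty Ω]
    (bad : ι → Ω → Prop) (Γ : ι → Finset ι)
    (d : ℕ) (x : ℝ) (hx0 : 0 ≤ x) (hx1 : x < 1) (hΓ : ∀ i, (Γ i).card ≤ d)
    (hindep : ∀ i (S : Finset ι), i ∉ S → Disjoint S (Γ i) →
      (Nat.card {ω // (∀ j ∈ S, ¬ bad j ω) ∧ bad i ω} : ℝ) ≤
        x * (1 - x) ^ d * Nat.card {ω // ∀ j ∈ S, ¬ bad j ω})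
    (S : Finset ι) : ∃ ω, ∀ j ∈ S, ¬ bad j ω := by
  classical
  induction S using Finset.induction_on with
  | empty => simp
  | insert a S ha ih =>
    by_contra! hcon
    obtain ⟨ω, hω⟩ := ih
    have hle := local_lemma_card_le bad Γ d x hx0 hx1.le hΓ hindep S a ha
    have heq : Nat.card {ω // (∀ j ∈ S, ¬ bad j ω) ∧ bad a ω} =
        Nat.card {ω // ∀ j ∈ S, ¬ bad j ω} := by
      refine Nat.card_congr (Equiv.subtypeEquivRight fun ω => and_iff_left_of_imp fun h => ?_)
      obtain ⟨j, hj, hb⟩ := hcon ω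
      rcases Finset.mem_insert.1 hj with rfl | hj
      · exact hb
      · exact absurd hb (h j hj)
    have : Nonempty {ω // ∀ j ∈ S, ¬ bad j ω} := ⟨ω, hω⟩
    have hpos : (0 : ℝ) < Nat.card {ω // ∀ j ∈ S, ¬ bad j ω} := by exact_mod_cast Nat.card_pos
    rw [heq] at hle
    nlinarith

/-- A two-colouring is constant on `N` and satisfies a property not depending on its values on `N`
with proportion at most `2 ^ (1 - |N|)` among those satisfying the property. -/
theorem card_constOn_mul_two_pow_le {V : Type*} [Fintype V] (N : Finset V) (hN : N.Nonempty)
    (P : (V → Bool) → Prop) (hP : ∀ f g : V → Bool, (∀ y ∉ N, f y = g y) → P f → P g) :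
    Nat.card {f : V → Bool // P f ∧ ∀ u ∈ N, ∀ w ∈ N, f u = f w} * 2 ^ (N.card - 1) ≤
      Nat.card {f : V → Bool // P f} := by
  classical
  obtain ⟨w, hw⟩ := hN
  have hcard : 2 ^ (N.card - 1) = Nat.card {T // T ∈ (N.erase w).powerset} := by
    rw [Nat.card_eq_fintype_card, Fintype.card_coe, Finset.card_powerset,
      Finset.card_erase_of_mem hw]
  rw [hcard, ← Nat.card_prod]
  refine Nat.card_le_card_of_injective
    (fun q => ⟨fun y => if y ∈ N.erase w then decide (y ∈ q.2.1) else q.1.1 y,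
      hP _ _ (fun y hy => ?_) q.1.2.1⟩) ?_
  · rw [if_neg fun h => hy (Finset.mem_of_mem_erase h)]
  · rintro ⟨⟨f, hf⟩, T, hT⟩ ⟨⟨g, hg⟩, U, hU⟩ h
    have h' : ∀ y, (if y ∈ N.erase w then decide (y ∈ T) else f y) =
        if y ∈ N.erase w then decide (y ∈ U) else g y := congrFun (Subtype.ext_iff.1 h)
    have hfg : f = g := by
      have hfw : f w = g w := by simpa using h' w
      funext y
      by_cases hy : y ∈ N
      · rw [hf.2 y hy w hw, hg.2 y hy w hw, hfw]
      · simpa [hy] using h' y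
    have hTU : T = U := by
      rw [Finset.mem_powerset] at hT hU
      ext y
      by_cases hy : y ∈ N.erase w
      · have := h' y
        simpa only [if_pos hy, decide_eq_decide] using this
      · exact iff_of_false (fun k => hy (hT k)) (fun k => hy (hU k))
    subst hfg hTU
    rfl

theorem inv_exp_one_le_one_sub_inv_pow (n : ℕ) :
    (Real.exp 1)⁻¹ ≤ (1 - ((n : ℝ) + 1)⁻¹) ^ n := by
  rcases Nat.eq_zero_or_pos n with rfl | hn
  · simpa using inv_le_one_of_one_le₀ (Real.one_le_exp zero_le_one)
  · have hn' : (0 : ℝ) < n := by exact_mod_cast hn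
    have h1 : (1 : ℝ) - ((n : ℝ) + 1)⁻¹ = (1 + (n : ℝ)⁻¹)⁻¹ := by field_simp; ring
    rw [h1, inv_pow]
    refine inv_anti₀ (by positivity) ?_
    calc (1 + (n : ℝ)⁻¹) ^ n ≤ Real.exp ((n : ℝ)⁻¹) ^ n := by
          gcongr
          rw [add_comm]
          exact Real.add_one_le_exp _
      _ = Real.exp 1 := by rw [← Real.exp_nat_mul, mul_inv_cancel₀ hn'.ne']

/-- Under the degree condition there is a two-colouring of the vertices for which no neighbourhood
of a vertex of degree at least two is monochromatic. -/
theorem exists_bool_coloring_not_constOn_neighborFinset {V : Type*} [Fintype V]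
    (G : SimpleGraph V) [DecidableRel G.Adj]
    (h : Real.exp 1 * (G.maxDegree : ℝ) ^ 2 ≤ (2 : ℝ) ^ ((G.minDegree : ℝ) - 1)) :
    ∃ f : V → Bool, ∀ v, 2 ≤ G.degree v →
      ¬ ∀ u ∈ G.neighborFinset v, ∀ w ∈ G.neighborFinset v, f u = f w := by
  classical
  rcases lt_or_ge G.maxDegree 2 with hΔ | hΔ
  · exact ⟨fun _ => true, fun v hv => absurd (G.degree_le_maxDegree v) (by omega)⟩
  have hΔ' : (2 : ℝ) ≤ G.maxDegree := by exact_mod_cast hΔ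
  have hδ : 1 ≤ G.minDegree := by
    by_contra! h0
    have h1 : (2 : ℝ) ^ ((G.minDegree : ℝ) - 1) ≤ 1 :=
      Real.rpow_le_one_of_one_le_of_nonpos one_le_two (by
        rw [Nat.lt_one_iff.1 h0]; norm_num)
    have h2 : (1 : ℝ) ≤ Real.exp 1 := Real.one_le_exp zero_le_one
    nlinarith
  have hpow : (2 : ℝ) ^ ((G.minDegree : ℝ) - 1) = 2 ^ (G.minDegree - 1) := by
    rw [← Real.rpow_natCast, Nat.cast_sub hδ, Nat.cast_one]
  rw [hpow] at h
  obtain ⟨d, hd⟩ : ∃ d, G.maxDegree ^ 2 = d + 1 := ⟨G.maxDegree ^ 2 - 1, by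
    have : 0 < G.maxDegree ^ 2 := by positivity
    omega⟩
  have hd' : (G.maxDegree : ℝ) ^ 2 = d + 1 := by exact_mod_cast hd
  have hd0 : (0 : ℝ) < d := by nlinarith
  have hp : ((2 : ℝ) ^ (G.minDegree - 1))⁻¹ ≤
      ((d : ℝ) + 1)⁻¹ * (1 - ((d : ℝ) + 1)⁻¹) ^ d := by
    calc ((2 : ℝ) ^ (G.minDegree - 1))⁻¹ ≤ (Real.exp 1 * (G.maxDegree : ℝ) ^ 2)⁻¹ :=
          inv_anti₀ (by positivity) h
      _ = ((d : ℝ) + 1)⁻¹ * (Real.exp 1)⁻¹ := by rw [hd', mul_inv_rev]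
      _ ≤ _ := by
        gcongr
        exact inv_exp_one_le_one_sub_inv_pow d
  refine (exists_forall_not_bad_of_local_lemma
    (fun (v : V) (f : V → Bool) =>
      ∀ u ∈ G.neighborFinset v, ∀ w ∈ G.neighborFinset v, f u = f w)
    (fun v => (G.neighborFinset v).biUnion fun w => (G.neighborFinset w).erase v)
    d ((d : ℝ) + 1)⁻¹ (by positivity) (inv_lt_one_of_one_lt₀ (by linarith))
    (fun v => ?_) (fun v S hv hS => ?_) Finset.univ).imp
    fun f hf v _ => hf v (Finset.mem_univ v)
  · have h1 := Finset.card_biUnion_le_card_mul (G.neighborFinset v)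
      (fun w => (G.neighborFinset w).erase v) (G.maxDegree - 1) fun w hw => by
        rw [Finset.card_erase_of_mem (by simpa [G.adj_comm] using hw)]
        exact Nat.sub_le_sub_right (G.degree_le_maxDegree w) 1
    refine h1.trans ?_
    have h2 : (G.neighborFinset v).card ≤ G.maxDegree := G.degree_le_maxDegree v
    obtain ⟨m, hm⟩ : ∃ m, G.maxDegree = m + 1 := ⟨G.maxDegree - 1, by omega⟩
    rw [hm] at hd h2 ⊢
    rw [Nat.add_sub_cancel]
    nlinarith
  · have hdeg : G.minDegree ≤ (G.neighborFinset v).card := G.minDegree_le_degree v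
    have hdisj : ∀ j ∈ S, ∀ u ∈ G.neighborFinset j, u ∉ G.neighborFinset v := by
      intro j hj u hu huv
      refine Finset.disjoint_left.1 hS hj (Finset.mem_biUnion.2 ⟨u, huv, ?_⟩)
      rw [Finset.mem_erase]
      refine ⟨fun e => hv (e ▸ hj), ?_⟩
      simpa [G.adj_comm] using hu
    have h1 := card_constOn_mul_two_pow_le (G.neighborFinset v)
      (Finset.card_pos.1 (by omega))
      (fun f => ∀ j ∈ S, ¬ ∀ u ∈ G.neighborFinset j, ∀ w ∈ G.neighborFinset j, f u = f w)
      (fun f g hfg hf j hj hg => hf j hj fun u hu w hw => by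
        rw [hfg u (hdisj j hj u hu), hfg w (hdisj j hj w hw)]
        exact hg u hu w hw)
    have h2 := (Nat.mul_le_mul_left _ (Nat.pow_le_pow_right two_pos
      (Nat.sub_le_sub_right hdeg 1))).trans h1
    refine le_trans ?_ (mul_le_mul_of_nonneg_right hp (Nat.cast_nonneg _))
    rw [inv_mul_eq_div, le_div_iff₀ (by positivity)]
    exact_mod_cast h2

/-- If `e·Δ² ≤ 2^(δ-1)` where `Δ` and `δ` are the maximum and minimum degree of the finite
graph `G`, then `χ_d(G) ≤ 2 χ(G)`. -/
theorem dynChromNum_le_two_mul_chromNum {V : Type*} [Fintype V] (G : SimpleGraph V)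
    [DecidableRel G.Adj]
    (h : Real.exp 1 * (G.maxDegree : ℝ) ^ 2 ≤ (2 : ℝ) ^ ((G.minDegree : ℝ) - 1)) :
    dynChromNum G ≤ 2 * chromNum G := by
  obtain ⟨f, hf⟩ := exists_bool_coloring_not_constOn_neighborFinset G h
  have hcol : G.Colorable (chromNum G) :=
    Nat.sInf_mem (s := {n | G.Colorable n}) ⟨_, G.colorable_of_fintype⟩
  obtain ⟨c⟩ := hcol
  let e : Bool × Fin (chromNum G) ≃ Fin (2 * chromNum G) :=
    (finTwoEquiv.symm.prodCongr (Equiv.refl _)).trans finProdFinEquiv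
  refine Nat.sInf_le ⟨fun v => e (f v, c v), fun u v huv heq => ?_, fun v hv => ?_⟩
  · exact c.valid huv (Prod.ext_iff.1 (e.injective heq)).2
  · have hdeg : 2 ≤ G.degree v := by
      rwa [← G.card_neighborFinset_eq_degree, ← Set.ncard_coe_finset, G.coe_neighborFinset]
    have hv' := hf v hdeg
    push Not at hv'
    obtain ⟨u, hu, w, hw, hne⟩ := hv'
    rw [G.mem_neighborFinset] at hu hw
    exact ⟨u, w, hu, hw, fun heq => hne (Prod.ext_iff.1 (e.injective heq)).1⟩
end

section
/- For every integer k ≥ 9 and every finite k-regular simple graph G, χ_d(G) ≤ 2·χ(G). -/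
open SimpleGraph Set

open Classical in
/-- The subsets of `S` that neither contain nor miss any hyperedge `N x` lying inside `S`. -/
noncomputable def splittingSets {V ι : Type*} (N : ι → Finset V) (S : Finset V) :
    Finset (Finset V) :=
  S.powerset.filter fun A => ∀ x, N x ⊆ S → ¬ N x ⊆ A ∧ ¬ Disjoint (N x) A

theorem mem_splittingSets {V ι : Type*} {N : ι → Finset V} {S A : Finset V} :
    A ∈ splittingSets N S ↔ A ⊆ S ∧ ∀ x, N x ⊆ S → ¬ N x ⊆ A ∧ ¬ Disjoint (N x) A := by
  simp [splittingSets]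

theorem mul_five_eighths_pow_le {k : ℕ} (hk : 9 ≤ k) :
    (k : ℝ) * (5 / 8) ^ (k - 2) ≤ 2 / 5 := by
  induction k, hk using Nat.le_induction with
  | base => norm_num
  | succ k hk ih =>
    have h : k + 1 - 2 = (k - 2) + 1 := by omega
    have hk' : (9 : ℝ) ≤ k := by exact_mod_cast hk
    have hp : (0 : ℝ) < (5 / 8) ^ (k - 2) := by positivity
    rw [h, pow_succ]
    push_cast
    nlinarith

/-- If adding a single vertex to a proper subset of `S` always multiplies the number of
splitting sets by at least `8 / 5`, then so does adding several vertices, with the matching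
power of `8 / 5`. -/
theorem card_splittingSets_le_of_subset {V ι : Type*} [DecidableEq V] {N : ι → Finset V}
    {S : Finset V}
    (h : ∀ T ⊂ S, ∀ v ∉ T,
      (8 / 5 : ℝ) * (splittingSets N T).card ≤ (splittingSets N (insert v T)).card)
    {T : Finset V} (hT : T ⊆ S) :
    ((splittingSets N T).card : ℝ) ≤
      (5 / 8) ^ (S \ T).card * (splittingSets N S).card := by
  induction hn : (S \ T).card generalizing T with
  | zero =>
    have : T = S := hT.antisymm (by simpa [Finset.sdiff_eq_empty_iff_subset] using hn)
    simp [this]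
  | succ n ih =>
    obtain ⟨v, hv⟩ : (S \ T).Nonempty := by rw [← Finset.card_pos]; omega
    obtain ⟨hvS, hvT⟩ := Finset.mem_sdiff.1 hv
    have h1 := h T (Finset.ssubset_iff_subset_ne.2 ⟨hT, by rintro rfl; exact hvT hvS⟩) v hvT
    have h2 := ih (T := insert v T) (Finset.insert_subset hvS hT) (by
      rw [Finset.sdiff_insert, Finset.card_erase_of_mem hv, hn]; rfl)
    rw [pow_succ]
    linarith

/-- The sets `A ⊆ insert v S` for which `A.erase v` is splitting but the hyperedge `E ∋ v` is
monochromatic inject into the splitting sets of a set missing all but one vertex of `E`. -/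
theorem exists_card_monochromatic_le {V ι : Type*} [DecidableEq V] {N : ι → Finset V}
    {S E : Finset V} {v : V} (hv : v ∉ S) (hvE : v ∈ E) (hE : E ⊆ insert v S)
    (hcard : 2 ≤ E.card) (B : Finset (Finset V))
    (hB : ∀ A ∈ B, A ⊆ insert v S ∧ A.erase v ∈ splittingSets N S ∧ (E ⊆ A ∨ Disjoint E A)) :
    ∃ T ⊆ S, (S \ T).card = E.card - 2 ∧ B.card ≤ (splittingSets N T).card := by
  obtain ⟨w, hw, hwv⟩ := Finset.exists_mem_ne (by omega : 1 < E.card) v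
  refine ⟨S \ E.erase w, Finset.sdiff_subset, ?_, ?_⟩
  · have : S \ (S \ E.erase w) = (E.erase w).erase v := by
      ext x
      have := @hE x
      simp only [Finset.mem_sdiff, Finset.mem_erase, Finset.mem_insert] at *
      grind
    rw [this, Finset.card_erase_of_mem (by simp [hvE, hwv.symm]), Finset.card_erase_of_mem hw]
    omega
  · refine Finset.card_le_card_of_injOn (fun A => A \ E.erase w) ?_ ?_
    · intro A hA
      obtain ⟨hAS, hAv, -⟩ := hB A hA
      rw [mem_splittingSets] at hAv
      simp only [Finset.mem_coe, mem_splittingSets]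
      constructor
      · intro x hx
        have := @hAS x
        simp only [Finset.mem_sdiff, Finset.mem_erase, Finset.mem_insert] at *
        grind
      · intro x hx
        obtain ⟨h1, h2⟩ := hAv.2 x (hx.trans Finset.sdiff_subset)
        constructor
        · intro h
          refine h1 fun y hy => ?_
          have a := hx hy
          have b := h hy
          simp only [Finset.mem_sdiff, Finset.mem_erase] at *
          grind
        · intro h
          refine h2 (Finset.disjoint_left.2 fun y hy hyA => ?_)
          have a := hx hy
          have b := Finset.disjoint_left.1 h hy
          simp only [Finset.mem_sdiff, Finset.mem_erase] at *
          grind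
    · intro A hA A' hA' h
      obtain ⟨-, -, hm⟩ := hB A hA
      obtain ⟨-, -, hm'⟩ := hB A' hA'
      have key : ∀ y, y ∈ A \ E.erase w ↔ y ∈ A' \ E.erase w := fun y => by
        rw [show A \ E.erase w = A' \ E.erase w from h]
      simp only [Finset.mem_sdiff, Finset.mem_erase] at key
      rw [Finset.disjoint_left] at hm hm'
      have hwk := key w
      ext y
      have hyk := key y
      have e1 : (E ⊆ A) → y ∈ E → y ∈ A := fun h => @h y
      have e2 : (E ⊆ A') → y ∈ E → y ∈ A' := fun h => @h y
      have e3 : (E ⊆ A) → w ∈ A := fun h => h hw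
      have e4 : (E ⊆ A') → w ∈ A' := fun h => h hw
      grind

/-- In a hypergraph whose hyperedges have size `k ≥ 9` and whose vertices lie in at most `k`
hyperedges, adding a vertex multiplies the number of splitting sets by at least `8 / 5`. -/
theorem card_splittingSets_insert {V ι : Type*} [DecidableEq V] [Fintype ι]
    {N : ι → Finset V} {k : ℕ} (hk : 9 ≤ k) (hN : ∀ x, (N x).card = k)
    (hdeg : ∀ v, (Finset.univ.filter fun x => v ∈ N x).card ≤ k) (S : Finset V) :
    ∀ v ∉ S, (8 / 5 : ℝ) * (splittingSets N S).card ≤ (splittingSets N (insert v S)).card := by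
  induction S using Finset.strongInduction with
  | H S ih =>
    intro v hv
    set F := splittingSets N S
    have hvF : ∀ A ∈ F, v ∉ A := fun A hA h => hv ((mem_splittingSets.1 hA).1 h)
    let X := Finset.univ.filter fun x => v ∈ N x
    let U := F ∪ F.image (insert v)
    have hU : U.card = 2 * F.card := by
      rw [Finset.card_union_of_disjoint, Finset.card_image_of_injOn, two_mul]
      · intro A hA A' hA' h
        rw [← Finset.erase_insert (hvF A hA), ← Finset.erase_insert (hvF A' hA')]
        exact congrArg (fun B => B.erase v) h
      · rw [Finset.disjoint_left]
        intro A hA hA'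
        obtain ⟨A', -, rfl⟩ := Finset.mem_image.1 hA'
        exact hvF _ hA (Finset.mem_insert_self _ _)
    have hUmem : ∀ A ∈ U, A ⊆ insert v S ∧ A.erase v ∈ F := by
      intro A hA
      rcases Finset.mem_union.1 hA with hA | hA
      · rw [Finset.erase_eq_of_notMem (hvF A hA)]
        exact ⟨(mem_splittingSets.1 hA).1.trans (Finset.subset_insert _ _), hA⟩
      · obtain ⟨A', hA', rfl⟩ := Finset.mem_image.1 hA
        rw [Finset.erase_insert (hvF A' hA')]
        exact ⟨Finset.insert_subset_insert _ (mem_splittingSets.1 hA').1, hA'⟩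
    let B : ι → Finset (Finset V) := fun x =>
      U.filter fun A => N x ⊆ insert v S ∧ (N x ⊆ A ∨ Disjoint (N x) A)
    have hcover : U ⊆ splittingSets N (insert v S) ∪ X.biUnion B := by
      intro A hA
      obtain ⟨hAS, hAF⟩ := hUmem A hA
      by_contra hcon
      rw [Finset.mem_union, not_or, mem_splittingSets] at hcon
      refine hcon.1 ⟨hAS, fun x hx => ?_⟩
      by_cases hvx : v ∈ N x
      · rw [← not_or]
        intro h
        exact hcon.2 (Finset.mem_biUnion.2
          ⟨x, by simpa [X] using hvx, Finset.mem_filter.2 ⟨hA, hx, h⟩⟩)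
      · have hxS : N x ⊆ S := (Finset.subset_insert_iff_of_notMem hvx).1 hx
        obtain ⟨h1, h2⟩ := (mem_splittingSets.1 hAF).2 x hxS
        refine ⟨fun h => h1 (Finset.subset_erase.2 ⟨h, hvx⟩), fun h => h2 ?_⟩
        exact h.mono_right (Finset.erase_subset _ _)
    have hB : ∀ x ∈ X, ((B x).card : ℝ) ≤ (5 / 8) ^ (k - 2) * F.card := by
      intro x hx
      by_cases hxS : N x ⊆ insert v S
      · obtain ⟨T, hTS, hT, hle⟩ := exists_card_monochromatic_le (N := N) hv
          (by simpa [X] using hx) hxS (by rw [hN]; omega) (B x) (fun A hA => by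
            obtain ⟨hA, -, h⟩ := Finset.mem_filter.1 hA
            exact ⟨(hUmem A hA).1, (hUmem A hA).2, h⟩)
        have := card_splittingSets_le_of_subset ih hTS
        rw [hT, hN] at this
        exact le_trans (by exact_mod_cast hle) this
      · have : B x = ∅ := Finset.filter_eq_empty_iff.2 fun A _ h => hxS h.1
        rw [this]
        simp only [Finset.card_empty, Nat.cast_zero]
        positivity
    have hsum : ((X.biUnion B).card : ℝ) ≤ 2 / 5 * F.card := by
      calc ((X.biUnion B).card : ℝ) ≤ ∑ x ∈ X, ((B x).card : ℝ) := by
            exact_mod_cast Finset.card_biUnion_le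
        _ ≤ X.card • ((5 / 8 : ℝ) ^ (k - 2) * F.card) := Finset.sum_le_card_nsmul _ _ _ hB
        _ ≤ k * ((5 / 8 : ℝ) ^ (k - 2) * F.card) := by
            rw [nsmul_eq_mul]
            gcongr
            exact hdeg v
        _ ≤ 2 / 5 * F.card := by
            rw [← mul_assoc]
            gcongr
            exact mul_five_eighths_pow_le hk
    have hle : (U.card : ℝ) ≤ (splittingSets N (insert v S)).card + (X.biUnion B).card := by
      exact_mod_cast (Finset.card_le_card hcover).trans (Finset.card_union_le _ _)
    rw [hU] at hle
    push_cast at hle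
    linarith

/-- A finite `k`-uniform hypergraph of maximum degree at most `k`, with `k ≥ 9`, has
property B. -/
theorem exists_splitting_set {V ι : Type*} [DecidableEq V] [Fintype V] [Fintype ι]
    {N : ι → Finset V} {k : ℕ} (hk : 9 ≤ k) (hN : ∀ x, (N x).card = k)
    (hdeg : ∀ v, (Finset.univ.filter fun x => v ∈ N x).card ≤ k) :
    ∃ A : Finset V, ∀ x, ¬ N x ⊆ A ∧ ¬ Disjoint (N x) A := by
  have hpos : ∀ S, 0 < (splittingSets N S).card := by
    intro S
    induction S using Finset.induction_on with
    | empty =>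
      refine Finset.card_pos.2 ⟨∅, mem_splittingSets.2 ⟨subset_rfl, fun x hx => ?_⟩⟩
      have := hN x
      rw [Finset.subset_empty.1 hx, Finset.card_empty] at this
      omega
    | insert v S hv ih =>
      have := card_splittingSets_insert hk hN hdeg S v hv
      have ih' : (0 : ℝ) < (splittingSets N S).card := by exact_mod_cast ih
      have : (0 : ℝ) < (splittingSets N (insert v S)).card := by linarith
      exact_mod_cast this
  obtain ⟨A, hA⟩ := Finset.card_pos.1 (hpos Finset.univ)
  exact ⟨A, fun x => (mem_splittingSets.1 hA).2 x (Finset.subset_univ _)⟩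

/-- For every `k ≥ 9`, every finite `k`-regular graph `G` satisfies `χ_d(G) ≤ 2 χ(G)`. -/
theorem dynChromNum_le_two_mul_chromNum_of_regular
    {V : Type*} [Fintype V] (G : SimpleGraph V) (k : ℕ) (hk : 9 ≤ k)
    (hreg : IsKRegular G k) :
    dynChromNum G ≤ 2 * chromNum G := by
  classical
  have hcol : G.Colorable (chromNum G) :=
    Nat.sInf_mem (s := {n | G.Colorable n}) ⟨_, G.colorable_of_fintype⟩
  obtain ⟨c⟩ := hcol
  have hcard : ∀ v, (G.neighborFinset v).card = k := fun v => by
    rw [← hreg v, Set.ncard_eq_toFinset_card']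
    rfl
  obtain ⟨A, hA⟩ := exists_splitting_set (N := fun v => G.neighborFinset v) hk hcard (fun v => by
    rw [← hcard v]
    refine Finset.card_le_card fun x hx => ?_
    simpa [G.adj_comm] using hx)
  refine Nat.sInf_le ⟨fun v => finProdFinEquiv (if v ∈ A then 0 else 1, c v), ?_, ?_⟩
  · intro u v huv h
    exact c.valid huv (Prod.ext_iff.1 (finProdFinEquiv.injective h)).2
  · intro v _
    obtain ⟨h1, h2⟩ := hA v
    obtain ⟨u, hu, huA⟩ := Finset.not_disjoint_iff.1 h2
    obtain ⟨w, hw, hwA⟩ := Finset.not_subset.1 h1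
    refine ⟨u, w, by simpa using hu, by simpa using hw, fun h => ?_⟩
    simpa [huA, hwA] using (Prod.ext_iff.1 (finProdFinEquiv.injective h)).1
end

section
/- There exists a constant c > 0 such that for every integer k ≥ 1 and every finite k-regular simple graph G, χ_d(G) ≤ min{2·χ(G), χ(G) + c·ln k + 1}. -/
open SimpleGraph Set

theorem exists_sign_extension {α ι : Type*} (S : ι → Finset α) (F : Finset ι) (w : ι → α → ℝ)
    (hw : ∀ i ∈ F, ∀ a ∈ S i, 0 < w i a) (y : α → ℝ)
    (hy : ∀ i ∈ F, ∑ a ∈ S i, w i a * y a = 0) (f : α → Bool)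
    (hf : ∀ i ∈ F, (∀ a ∈ S i, y a = 0) → ∃ a ∈ S i, ∃ b ∈ S i, f a ≠ f b) :
    ∃ g : α → Bool, ∀ i ∈ F, ∃ a ∈ S i, ∃ b ∈ S i, g a ≠ g b := by
  refine ⟨fun a => if 0 < y a then true else if y a < 0 then false else f a, fun i hi => ?_⟩
  by_cases h0 : ∀ a ∈ S i, y a = 0
  · obtain ⟨a, ha, b, hb, hab⟩ := hf i hi h0
    exact ⟨a, ha, b, hb, by simpa [h0 a ha, h0 b hb] using hab⟩
  · push Not at h0
    obtain ⟨a₀, ha₀, hne⟩ := h0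
    have hpos : ∃ a ∈ S i, 0 < y a := by
      by_contra! hcon
      have := (Finset.sum_eq_zero_iff_of_nonpos
        (fun a ha => mul_nonpos_of_nonneg_of_nonpos (hw i hi a ha).le (hcon a ha))).1 (hy i hi)
        a₀ ha₀
      exact (mul_ne_zero (hw i hi a₀ ha₀).ne' hne) this
    have hneg : ∃ a ∈ S i, y a < 0 := by
      by_contra! hcon
      have := (Finset.sum_eq_zero_iff_of_nonneg
        (fun a ha => mul_nonneg (hw i hi a ha).le (hcon a ha))).1 (hy i hi) a₀ ha₀
      exact (mul_ne_zero (hw i hi a₀ ha₀).ne' hne) this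
    obtain ⟨a, ha, hya⟩ := hpos
    obtain ⟨b, hb, hyb⟩ := hneg
    exact ⟨a, ha, b, hb, by simp [hya, hyb, hyb.le]⟩

/-- Lovász: a finite hypergraph in which every nonempty set of edges covers more
vertices than it has members is 2-colorable. -/
theorem exists_twoColoring_of_card_lt_card_biUnion {α ι : Type*} [DecidableEq α]
    (S : ι → Finset α) (F : Finset ι)
    (hF : ∀ F' ⊆ F, F'.Nonempty → F'.card < (F'.biUnion S).card) :
    ∃ f : α → Bool, ∀ i ∈ F, ∃ a ∈ S i, ∃ b ∈ S i, f a ≠ f b := by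
  induction F using Finset.strongInduction with
  | H F ih =>
    rcases F.eq_empty_or_nonempty with rfl | hne
    · exact ⟨fun _ => true, by simp⟩
    set U := F.biUnion S with hU
    let φ : (U → ℝ) →ₗ[ℝ] (F → ℝ) :=
      LinearMap.pi fun i => ∑ a : U, if (a : α) ∈ S i then LinearMap.proj a else 0
    have hφ : ∀ x i, φ x i = ∑ a : U, if (a : α) ∈ S i then x a else 0 := by
      intro x i
      simp only [φ, LinearMap.pi_apply, LinearMap.sum_apply]
      exact Finset.sum_congr rfl fun a _ => by split_ifs <;> simp
    have hker : LinearMap.ker φ ≠ ⊥ := by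
      apply LinearMap.ker_ne_bot_of_finrank_lt
      simpa using hF F subset_rfl hne
    obtain ⟨x, hx, hx0⟩ := (Submodule.ne_bot_iff _).1 hker
    let y : α → ℝ := fun a => if h : a ∈ U then x ⟨a, h⟩ else 0
    have hy : ∀ i ∈ F, ∑ a ∈ S i, y a = 0 := by
      intro i hi
      have hsub : S i ⊆ U := Finset.subset_biUnion_of_mem S hi
      have h := congrFun (LinearMap.mem_ker.1 hx) ⟨i, hi⟩
      rw [hφ] at h
      have h2 : ∑ a : U, (if (a : α) ∈ S i then x a else 0)
          = ∑ a : U, (if (a : α) ∈ S i then y a else 0) :=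
        Finset.sum_congr rfl fun a _ => by simp [y]
      rw [h2, Finset.sum_coe_sort U (fun a => if a ∈ S i then y a else 0),
        ← Finset.sum_filter, Finset.filter_mem_eq_inter, Finset.inter_eq_right.2 hsub] at h
      simpa using h
    have hlt : {i ∈ F | ∀ a ∈ S i, y a = 0} ⊂ F := by
      rw [Finset.filter_ssubset]
      obtain ⟨⟨a, ha⟩, hxa⟩ := Function.ne_iff.1 hx0
      obtain ⟨i, hi, hai⟩ := Finset.mem_biUnion.1 ha
      exact ⟨i, hi, fun hall => hxa (by simpa [y, ha] using hall a hai)⟩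
    obtain ⟨f, hf⟩ := ih _ hlt fun F' hF' => hF F' (hF'.trans hlt.subset)
    exact exists_sign_extension S F (fun _ _ => 1) (by simp) y (by simpa using hy) f
      fun i hi h0 => hf i (Finset.mem_filter.2 ⟨hi, h0⟩)

theorem SimpleGraph.mem_of_reachable_of_closed {V : Type*} (G : SimpleGraph V) {S : Set V}
    (hS : ∀ ⦃u w⦄, u ∈ S → G.Adj u w → w ∈ S)
    {a b : V} (ha : a ∈ S) (hab : G.Reachable a b) : b ∈ S := by
  obtain ⟨p⟩ := hab
  induction p with
  | nil => exact ha
  | cons h _ ih => exact ih (hS ha h)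

/-- The neighbors of `v` receive at least two values under `f`. -/
def SimpleGraph.SplitsNeighbors {V α : Type*} (G : SimpleGraph V) (f : V → α) (v : V) : Prop :=
  ∃ u w, G.Adj v u ∧ G.Adj v w ∧ f u ≠ f w

namespace SimpleGraph

section Regular

variable {V : Type*} [Fintype V] (G : SimpleGraph V) [DecidableRel G.Adj]

theorem bipartiteBelow_adj_subset_neighborFinset (F : Finset V) (x : V) :
    F.bipartiteBelow G.Adj x ⊆ G.neighborFinset x := fun v hv => by
  simpa using ((Finset.mem_bipartiteBelow _).1 hv).2.symm

variable [DecidableEq V]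

theorem card_mul_eq_sum_card_bipartiteBelow {k : ℕ} (hG : G.IsRegularOfDegree k) (F : Finset V) :
    F.card * k = ∑ x ∈ F.biUnion fun v => G.neighborFinset v,
      (F.bipartiteBelow G.Adj x).card := by
  rw [← Finset.sum_card_bipartiteAbove_eq_sum_card_bipartiteBelow, ← smul_eq_mul,
    ← Finset.sum_const]
  refine Finset.sum_congr rfl fun v hv => ?_
  rw [← hG v, ← card_neighborFinset_eq_degree]
  congr 1
  ext x
  simp only [Finset.mem_bipartiteAbove, mem_neighborFinset, iff_and_self]
  exact fun h => Finset.mem_biUnion.2 ⟨v, hv, by simpa⟩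

theorem card_le_card_biUnion_neighborFinset {k : ℕ} (hk : 0 < k) (hG : G.IsRegularOfDegree k)
    (F : Finset V) : F.card ≤ (F.biUnion fun v => G.neighborFinset v).card := by
  refine Nat.le_of_mul_le_mul_right ?_ hk
  rw [card_mul_eq_sum_card_bipartiteBelow G hG]
  refine Finset.sum_le_card_nsmul _ _ _ fun x _ => ?_
  simpa [hG x] using Finset.card_le_card (G.bipartiteBelow_adj_subset_neighborFinset F x)

theorem mem_of_card_biUnion_neighborFinset_le {k : ℕ} (hG : G.IsRegularOfDegree k) {F : Finset V}
    (hF : (F.biUnion fun v => G.neighborFinset v).card ≤ F.card) {u w : V}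
    (hu : u ∈ F.biUnion fun v => G.neighborFinset v) (huw : G.Adj u w) : w ∈ F := by
  by_contra hw
  have h : ∑ x ∈ F.biUnion fun v => G.neighborFinset v, (F.bipartiteBelow G.Adj x).card <
      ∑ x ∈ F.biUnion fun v => G.neighborFinset v, k := by
    refine Finset.sum_lt_sum (fun x _ => ?_) ⟨u, hu, ?_⟩
    · simpa [hG x] using Finset.card_le_card (G.bipartiteBelow_adj_subset_neighborFinset F x)
    · have : F.bipartiteBelow G.Adj u ⊂ G.neighborFinset u :=
        Finset.ssubset_iff_subset_ne.2 ⟨G.bipartiteBelow_adj_subset_neighborFinset F u, fun h => hw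
          ((Finset.mem_bipartiteBelow _).1 (h ▸ (G.mem_neighborFinset u w).2 huw)).1⟩
      simpa [hG u] using Finset.card_lt_card this
  rw [← card_mul_eq_sum_card_bipartiteBelow G hG, Finset.sum_const, smul_eq_mul] at h
  exact absurd (Nat.mul_le_mul_right k hF) (not_le.2 h)

/-- A set of vertices in the component of `r` has more neighbors than members, unless it
contains a side of the component. -/
theorem card_lt_card_biUnion_neighborFinset_or {k : ℕ} (hG : G.IsRegularOfDegree k)
    {F : Finset V} (hF : F.Nonempty) {r : V} (hr : ∀ v ∈ F, G.Reachable r v) :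
    F.card < (F.biUnion fun v => G.neighborFinset v).card ∨
      ∀ v, G.Reachable r v →
        v ∈ F ∨ ((∃ w ∈ F, G.Adj w v) ∧ ∀ w, G.Adj v w → w ∈ F) := by
  by_contra! h
  obtain ⟨hle, v, hv, hvF, hvU⟩ := h
  obtain ⟨a, ha⟩ := hF
  have := G.mem_of_reachable_of_closed
    (S := {v | v ∈ F ∨ v ∈ F.biUnion fun v => G.neighborFinset v})
    (fun u w hu huw => ?_) (Or.inl ha) ((hr a ha).symm.trans hv)
  · rcases this with h | h
    · exact hvF h
    · obtain ⟨w, hw, hwF⟩ := hvU (by simpa using h)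
      exact hwF (mem_of_card_biUnion_neighborFinset_le G hG hle h hw)
  · rcases hu with hu | hu
    · exact Or.inr (Finset.mem_biUnion.2 ⟨u, hu, by simpa⟩)
    · exact Or.inl (mem_of_card_biUnion_neighborFinset_le G hG hle hu huw)

theorem exists_splitsNeighbors_of_card_lt {F : Finset V}
    (hF : ∀ F' ⊆ F, F'.Nonempty → F'.card < (F'.biUnion fun v => G.neighborFinset v).card) :
    ∃ f : V → Bool, ∀ v ∈ F, G.SplitsNeighbors f v := by
  obtain ⟨f, hf⟩ := exists_twoColoring_of_card_lt_card_biUnion (fun v => G.neighborFinset v) F hF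
  refine ⟨f, fun v hv => ?_⟩
  obtain ⟨a, ha, b, hb, hab⟩ := hf v hv
  exact ⟨a, b, by simpa using ha, by simpa using hb, hab⟩

theorem exists_splitsNeighbors_off_edge {k : ℕ} (hG : G.IsRegularOfDegree k) {x y : V}
    (hxy : G.Adj x y) :
    ∃ f : V → Bool, ∀ v, G.Reachable x v → v ≠ x → v ≠ y → G.SplitsNeighbors f v := by
  classical
  obtain ⟨f, hf⟩ := G.exists_splitsNeighbors_of_card_lt
    (F := {v | G.Reachable x v ∧ v ≠ x ∧ v ≠ y}) fun F' hF' hne => by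
      refine (G.card_lt_card_biUnion_neighborFinset_or hG hne (r := x)
        fun v hv => (Finset.mem_filter.1 (hF' hv)).2.1).resolve_right fun h => ?_
      rcases h x .rfl with h | ⟨-, h⟩
      · simpa using hF' h
      · simpa using hF' (h y hxy)
  exact ⟨f, fun v h1 h2 h3 => hf v (by simp [h1, h2, h3])⟩

theorem exists_splitsNeighbors_prod_of_not_bipartite {k : ℕ} (hG : G.IsRegularOfDegree k)
    {α : Type*} {c : V → α} (hc : ∀ ⦃u v⦄, G.Adj u v → c u ≠ c v) {r : V}
    (hr : ¬ ∃ s : V → Bool, ∀ u v, G.Reachable r u → G.Adj u v → s u ≠ s v) :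
    ∃ f : V → Bool, ∀ v, G.Reachable r v → 0 < k →
      G.SplitsNeighbors (fun u => (c u, f u)) v := by
  classical
  have key (i : α) : ∃ f : V → Bool, ∀ v, G.Reachable r v → (∀ u, G.Adj v u → c u = i) →
      G.SplitsNeighbors f v := by
    obtain ⟨f, hf⟩ := G.exists_splitsNeighbors_of_card_lt
      (F := {v | G.Reachable r v ∧ ∀ u, G.Adj v u → c u = i}) fun F' hF' hne => by
        refine (G.card_lt_card_biUnion_neighborFinset_or hG hne (r := r)
          fun v hv => (Finset.mem_filter.1 (hF' hv)).2.1).resolve_right fun h => hr ?_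
        have hF (v : V) (hv : v ∈ F') (u : V) (huv : G.Adj v u) : c u = i :=
          (Finset.mem_filter.1 (hF' hv)).2.2 u huv
        refine ⟨fun v => decide (c v = i), fun u v hu huv => ?_⟩
        rcases h u hu with h | ⟨⟨w, hw, hwu⟩, -⟩
        · have := hF u h v huv
          have := hc huv
          grind
        · have := hF w hw u hwu
          have := hc huv
          grind
    exact ⟨f, fun v h1 h2 => hf v (by simpa using ⟨h1, h2⟩)⟩
  choose f hf using key
  refine ⟨fun u => f (c u) u, fun v hv hk => ?_⟩
  obtain ⟨u, hu⟩ := (G.degree_pos_iff_exists_adj v).1 (by rw [hG v]; exact hk)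
  by_cases hmono : ∀ w, G.Adj v w → c w = c u
  · obtain ⟨a, b, ha, hb, hab⟩ := hf (c u) v hv hmono
    refine ⟨a, b, ha, hb, fun h => hab ?_⟩
    have := (Prod.mk.inj h).2
    dsimp only at this
    rwa [hmono a ha, hmono b hb] at this
  · push Not at hmono
    obtain ⟨w, hw, hne⟩ := hmono
    exact ⟨w, u, hw, hu, fun h => hne (Prod.mk.inj h).1⟩

/-- In a bipartite component, if the neighborhoods of one side can be split,
so can those of the other side. -/
theorem exists_splitsNeighbors_other_side {k : ℕ} (hk : 0 < k) (hG : G.IsRegularOfDegree k)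
    {r : V} {s : V → Bool} (hs : ∀ u v, G.Reachable r u → G.Adj u v → s u ≠ s v) {b : Bool}
    (h : ∃ f : V → Bool, ∀ v, G.Reachable r v → s v = b → G.SplitsNeighbors f v) :
    ∃ f : V → Bool, ∀ v, G.Reachable r v → s v = !b → G.SplitsNeighbors f v := by
  classical
  obtain ⟨f, hf⟩ := h
  have hcard (d : Bool) : ({v | G.Reachable r v ∧ s v = d} : Finset V).card ≤
      ({v | G.Reachable r v ∧ s v = !d} : Finset V).card := by
    refine (G.card_le_card_biUnion_neighborFinset hk hG _).trans (Finset.card_le_card ?_)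
    intro x hx
    obtain ⟨v, hv, hvx⟩ := Finset.mem_biUnion.1 hx
    simp only [Finset.mem_filter, Finset.mem_univ, true_and, mem_neighborFinset] at hv hvx ⊢
    have := hs v x hv.1 hvx
    exact ⟨hv.1.trans hvx.reachable, Bool.eq_not.2 fun h => this (hv.2.trans h.symm)⟩
  set X : Finset V := {v | G.Reachable r v ∧ s v = !b} with hX
  set Y : Finset V := {v | G.Reachable r v ∧ s v = b} with hY
  have hXY : X.card = Y.card := le_antisymm (by simpa using hcard (!b)) (hcard b)
  have memX {v} : v ∈ X ↔ G.Reachable r v ∧ s v = !b := by simp [hX]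
  have memY {v} : v ∈ Y ↔ G.Reachable r v ∧ s v = b := by simp [hY]
  have adjXY {u v} (hu : u ∈ X) (huv : G.Adj u v) : v ∈ Y := by
    rw [memX] at hu
    have := hs u v hu.1 huv
    refine memY.2 ⟨hu.1.trans huv.reachable, ?_⟩
    by_contra h
    exact this (hu.2.trans (Bool.eq_not.2 h).symm)
  have adjYX {u v} (hu : u ∈ Y) (huv : G.Adj u v) : v ∈ X := by
    rw [memY] at hu
    have := hs u v hu.1 huv
    exact memX.2 ⟨hu.1.trans huv.reachable, Bool.eq_not.2 fun h => this (hu.2.trans h.symm)⟩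
  let e : X ≃ Y := Finset.equivOfCardEq hXY
  let N (v : V) (t : Bool) : ℝ := ({u ∈ G.neighborFinset v | f u = t} : Finset V).card
  let W (v u : V) : ℝ := N v (!f u)
  have hWpos {v u : V} (hv : v ∈ Y) : 0 < W v u := by
    obtain ⟨a, c, ha, hc, hac⟩ := hf v (memY.1 hv).1 (memY.1 hv).2
    simp only [W, N, Nat.cast_pos, Finset.card_pos]
    by_cases h : f a = !f u
    · exact ⟨a, by simp [ha, h]⟩
    · exact ⟨c, Finset.mem_filter.2 ⟨by simpa, Bool.eq_not.2 fun hcu =>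
        h (Bool.eq_not.2 (hcu ▸ hac))⟩⟩
  let σ (u : V) : ℝ := if f u then 1 else -1
  have hWσ (v : V) : ∑ u ∈ G.neighborFinset v, W v u * σ u = 0 := by
    rw [← Finset.sum_filter_add_sum_filter_not _ (fun u => f u = true)]
    rw [Finset.sum_congr rfl (g := fun _ => N v false),
      Finset.sum_congr (s₁ := {u ∈ G.neighborFinset v | ¬ f u = true})
        (s₂ := {u ∈ G.neighborFinset v | f u = false}) (g := fun _ => - N v true)]
    · simp [N]; ring
    · ext; simp
    · intro u hu
      simp [W, σ, (Finset.mem_filter.1 hu).2]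
    · intro u hu
      simp [W, σ, (Finset.mem_filter.1 hu).2]
  have sum_sub (Z : Finset V) (v : V) (hZ : G.neighborFinset v ⊆ Z) (g : V → ℝ) :
      ∑ u : Z, (if G.Adj v u then g u else 0) = ∑ u ∈ G.neighborFinset v, g u := by
    rw [Finset.sum_coe_sort Z (fun u => if G.Adj v u then g u else 0), ← Finset.sum_filter]
    congr 1
    ext u
    simp only [Finset.mem_filter, mem_neighborFinset, and_iff_right_iff_imp]
    exact fun h => hZ (by simpa)
  let M : Matrix X X ℝ := fun a c => if G.Adj (e a) c then W (e a) c else 0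
  have hXne : Nonempty X := by
    by_cases hsr : s r = !b
    · exact ⟨r, memX.2 ⟨.rfl, hsr⟩⟩
    · obtain ⟨u, hu⟩ := (G.degree_pos_iff_exists_adj r).1 (by rw [hG r]; exact hk)
      exact ⟨u, adjYX (memY.2 ⟨.rfl, by simpa using hsr⟩) hu⟩
  have hdet : M.det = 0 := by
    refine Matrix.exists_mulVec_eq_zero_iff.1 ⟨fun c => σ c, fun h => ?_, ?_⟩
    · have := congrFun h hXne.some
      simp only [σ, Pi.zero_apply] at this
      split_ifs at this <;> norm_num at this
    · ext a
      have := sum_sub X (e a) (fun u hu => adjYX (e a).2 (by simpa using hu))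
        (fun u => W (e a) u * σ u)
      rw [hWσ] at this
      simpa [Matrix.mulVec, dotProduct, M, ite_mul] using this
  obtain ⟨z, hz0, hz⟩ := Matrix.exists_vecMul_eq_zero_iff.2 hdet
  let y (v : V) : ℝ := if h : v ∈ Y then z (e.symm ⟨v, h⟩) else 0
  have hy (x : V) (hx : x ∈ X) : ∑ v ∈ G.neighborFinset x, W v x * y v = 0 := by
    have h1 := congrFun hz ⟨x, hx⟩
    rw [← sum_sub Y x (fun u hu => adjXY hx (by simpa using hu)), ← e.sum_comp]
    simp only [Matrix.vecMul, dotProduct, M, Pi.zero_apply] at h1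
    refine (Finset.sum_congr rfl fun a _ => ?_).trans h1
    simp [y, G.adj_comm x, mul_comm]
  obtain ⟨g₀, hg₀⟩ := G.exists_splitsNeighbors_of_card_lt
    (F := {x ∈ X | ∀ v, G.Adj x v → y v = 0}) fun F' hF' hne => by
      refine (G.card_lt_card_biUnion_neighborFinset_or hG hne (r := r)
        fun v hv => (memX.1 (Finset.mem_filter.1 (hF' hv)).1).1).resolve_right fun h => hz0 ?_
      ext a
      have hsa := memY.1 (e a).2
      have hya : y (e a) = 0 := by
        rcases h (e a) hsa.1 with h | ⟨⟨w, hw, hwa⟩, -⟩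
        · exact absurd (hsa.2.symm.trans (memX.1 (Finset.mem_filter.1 (hF' h)).1).2) (by simp)
        · exact (Finset.mem_filter.1 (hF' hw)).2 _ hwa
      simpa [y] using hya
  obtain ⟨g, hg⟩ := exists_sign_extension (fun v => G.neighborFinset v) X (fun x v => W v x)
    (fun x hx v hv => hWpos (adjXY hx (by simpa using hv))) y hy g₀ fun x hx h0 => by
      obtain ⟨a, c, ha, hc, hac⟩ := hg₀ x (Finset.mem_filter.2 ⟨hx, by simpa using h0⟩)
      exact ⟨a, by simpa, c, by simpa, hac⟩
  refine ⟨g, fun x h1 h2 => ?_⟩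
  obtain ⟨a, ha, c, hc, hac⟩ := hg x (memX.2 ⟨h1, h2⟩)
  exact ⟨a, c, by simpa using ha, by simpa using hc, hac⟩

theorem exists_dynamic_of_bipartite {k : ℕ} (hk : 2 ≤ k) (hG : G.IsRegularOfDegree k)
    {r : V} {s : V → Bool} (hs : ∀ u v, G.Reachable r u → G.Adj u v → s u ≠ s v) :
    ∃ g : V → Bool × Bool, ∀ v, G.Reachable r v →
      (∀ u, G.Adj v u → g v ≠ g u) ∧ G.SplitsNeighbors g v := by
  have hs' (u v : V) (hu : G.Reachable r u) (huv : G.Adj u v) : s v = !s u :=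
    Bool.eq_not.2 (hs u v hu huv).symm
  by_cases hex : ∃ b, ∃ f : V → Bool, ∀ v, G.Reachable r v → s v = b → G.SplitsNeighbors f v
  · obtain ⟨b, hb⟩ := hex
    have hb' := G.exists_splitsNeighbors_other_side (by omega) hG hs hb
    have hall (d : Bool) :
        ∃ f : V → Bool, ∀ v, G.Reachable r v → s v = d → G.SplitsNeighbors f v := by
      rcases Bool.eq_or_eq_not d b with rfl | rfl
      · exact hb
      · exact hb'
    choose f hf using hall
    refine ⟨fun u => (s u, f (!s u) u), fun v hv => ⟨fun u huv h => ?_, ?_⟩⟩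
    · exact hs v u hv huv (Prod.mk.inj h).1
    · obtain ⟨a, c, ha, hc, hac⟩ := hf (s v) v hv rfl
      refine ⟨a, c, ha, hc, fun h => hac ?_⟩
      have := (Prod.mk.inj h).2
      simpa only [hs' v a hv ha, hs' v c hv hc, Bool.not_not] using this
  · have hother (x y : V) : ∃ w, G.Adj x w ∧ w ≠ y := by
      obtain ⟨w, hw, hne⟩ := Finset.exists_mem_ne
        (s := G.neighborFinset x) (by rw [card_neighborFinset_eq_degree, hG x]; omega) y
      exact ⟨w, by simpa using hw, hne⟩
    obtain ⟨y, hry⟩ := (G.degree_pos_iff_exists_adj r).1 (by rw [hG r]; omega)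
    have hsry := hs r y .rfl hry
    obtain ⟨f, hf⟩ := G.exists_splitsNeighbors_off_edge hG hry
    have hr : ¬ G.SplitsNeighbors f r := fun h => hex ⟨s r, f, fun v hv hsv => by
      by_cases hvr : v = r
      · exact hvr ▸ h
      · exact hf v hv hvr fun hvy => hsry (hvy ▸ hsv).symm⟩
    have hy : ¬ G.SplitsNeighbors f y := fun h => hex ⟨s y, f, fun v hv hsv => by
      by_cases hvy : v = y
      · exact hvy ▸ h
      · exact hf v hv (fun hvr => hsry (hvr ▸ hsv)) hvy⟩
    have hr' (u : V) (hu : G.Adj r u) : f u = f y := by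
      by_contra h
      exact hr ⟨u, y, hu, hry, h⟩
    have hy' (u : V) (hu : G.Adj y u) : f u = f r := by
      by_contra h
      exact hy ⟨u, r, hu, hry.symm, h⟩
    let g (v : V) : Bool × Bool :=
      if v = r then (s y, !f y) else if v = y then (s r, !f r) else (s v, f v)
    have gr : g r = (s y, !f y) := by simp [g]
    have gy : g y = (s r, !f r) := by simp [g, hry.ne']
    have g' {v} (h1 : v ≠ r) (h2 : v ≠ y) : g v = (s v, f v) := by simp [g, h1, h2]
    have hgr (u : V) (hu : G.Adj r u) : g r ≠ g u := by
      by_cases huy : u = y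
      · subst huy
        rw [gr, gy]
        exact fun h => hsry (Prod.mk.inj h).1.symm
      · rw [gr, g' hu.ne' huy, hr' u hu]
        simp
    have hgy (u : V) (hu : G.Adj y u) : g y ≠ g u := by
      by_cases hur : u = r
      · subst hur
        rw [gr, gy]
        exact fun h => hsry (Prod.mk.inj h).1
      · rw [gy, g' hur hu.ne', hy' u hu]
        simp
    refine ⟨g, fun v hv => ⟨fun u hu => ?_, ?_⟩⟩
    · by_cases hvr : v = r
      · exact hvr ▸ hgr u (hvr ▸ hu)
      by_cases hvy : v = y
      · exact hvy ▸ hgy u (hvy ▸ hu)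
      by_cases hur : u = r
      · exact hur ▸ (hgr v (hur ▸ hu.symm)).symm
      by_cases huy : u = y
      · exact huy ▸ (hgy v (huy ▸ hu.symm)).symm
      rw [g' hvr hvy, g' hur huy]
      exact fun h => hs v u hv hu (Prod.mk.inj h).1
    · by_cases h1 : G.Adj v r
      · obtain ⟨w, hw, hwr⟩ := hother v r
        refine ⟨w, r, hw, h1, ?_⟩
        have hvw := hs' v w hv hw
        have hsvr := hs' v r hv h1
        have hwy : w ≠ y := by
          rintro rfl
          exact hsry (hsvr.trans hvw.symm)
        rw [gr, g' hwr hwy, hvw, ← hsvr]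
        exact fun h => hsry (Prod.mk.inj h).1
      by_cases h2 : G.Adj v y
      · obtain ⟨w, hw, hwy⟩ := hother v y
        refine ⟨w, y, hw, h2, ?_⟩
        have hvw := hs' v w hv hw
        have hsvy := hs' v y hv h2
        have hwr : w ≠ r := by
          rintro rfl
          exact h1 hw
        rw [gy, g' hwr hwy, hvw, ← hsvy]
        exact fun h => hsry (Prod.mk.inj h).1.symm
      obtain ⟨a, c, ha, hc, hac⟩ := hf v hv (fun h => h2 (h ▸ hry)) (fun h => h1 (h ▸ hry.symm))
      refine ⟨a, c, ha, hc, ?_⟩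
      rw [g' (fun h => h1 (h ▸ ha)) (fun h => h2 (h ▸ ha)),
        g' (fun h => h1 (h ▸ hc)) (fun h => h2 (h ▸ hc))]
      exact fun h => hac (Prod.mk.inj h).2

theorem exists_dynamic_two_mul {k n : ℕ} (hk : 2 ≤ k) (hG : G.IsRegularOfDegree k)
    (hn : G.Colorable n) :
    ∃ g : V → Fin (2 * n), ∀ v, (∀ u, G.Adj v u → g v ≠ g u) ∧ G.SplitsNeighbors g v := by
  obtain ⟨c⟩ := hn
  have hc : ∀ ⦃u v⦄, G.Adj u v → c u ≠ c v := fun u v h => c.valid h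
  have key (C : G.ConnectedComponent) : ∃ g : V → Fin n × Bool, ∀ v, G.connectedComponentMk v = C →
      (∀ u, G.Adj v u → g v ≠ g u) ∧ G.SplitsNeighbors g v := by
    induction C using ConnectedComponent.ind with | _ r
    by_cases hr : ∃ s : V → Bool, ∀ u v, G.Reachable r u → G.Adj u v → s u ≠ s v
    · obtain ⟨s, hs⟩ := hr
      obtain ⟨g, hg⟩ := G.exists_dynamic_of_bipartite hk hG hs
      obtain ⟨y, hry⟩ := (G.degree_pos_iff_exists_adj r).1 (by rw [hG r]; omega)
      have hinj : Function.Injective fun p : Bool × Bool => (if p.1 then c r else c y, p.2) := by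
        have h1 := hc hry
        have h2 := h1.symm
        rintro ⟨a, b⟩ ⟨a', b'⟩ h
        cases a <;> cases a' <;> simp_all
      refine ⟨fun v => (if (g v).1 then c r else c y, (g v).2), fun v hv => ?_⟩
      obtain ⟨h1, a, b, ha, hb, hab⟩ := hg v (ConnectedComponent.eq.1 hv).symm
      exact ⟨fun u hu => hinj.ne (h1 u hu), a, b, ha, hb, hinj.ne hab⟩
    · obtain ⟨f, hf⟩ := G.exists_splitsNeighbors_prod_of_not_bipartite hG hc hr
      exact ⟨fun v => (c v, f v), fun v hv => ⟨fun u hu h => hc hu (Prod.mk.inj h).1,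
        hf v (ConnectedComponent.eq.1 hv).symm (by omega)⟩⟩
  choose g hg using key
  let e : Fin n × Bool ≃ Fin (2 * n) := Fintype.equivFinOfCardEq (by simp [mul_comm])
  have hcomp {v u : V} (h : G.Adj v u) : G.connectedComponentMk u = G.connectedComponentMk v :=
    ConnectedComponent.eq.2 h.symm.reachable
  refine ⟨fun v => e (g (G.connectedComponentMk v) v), fun v => ?_⟩
  obtain ⟨h1, a, b, ha, hb, hab⟩ := hg _ v rfl
  refine ⟨fun u hu => e.injective.ne ?_, a, b, ha, hb, e.injective.ne ?_⟩
  · rw [hcomp hu]; exact h1 u hu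
  · rw [hcomp ha, hcomp hb]; exact hab

end Regular

end SimpleGraph

/-- The symmetric Lovász local lemma, for the uniform measure on a finite type. -/
theorem exists_forall_notMem_of_local {Ω ι : Type*} [Fintype Ω] [Nonempty Ω] [DecidableEq Ω]
    [Fintype ι] [DecidableEq ι] (A : ι → Finset Ω) (N : ι → Finset ι) {p : ℝ} (hp : 0 ≤ p)
    {d : ℕ} (hd : 0 < d) (hN : ∀ i, (N i).card ≤ d) (hpd : 4 * p * d ≤ 1)
    (hA : ∀ i (S : Finset ι), Disjoint S (N i) →
      (({ω ∈ A i | ∀ j ∈ S, ω ∉ A j} : Finset Ω).card : ℝ) ≤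
        p * ({ω | ∀ j ∈ S, ω ∉ A j} : Finset Ω).card) :
    ∃ ω, ∀ i, ω ∉ A i := by
  let B (S : Finset ι) : Finset Ω := {ω | ∀ j ∈ S, ω ∉ A j}
  have memB {S ω} : ω ∈ B S ↔ ∀ j ∈ S, ω ∉ A j := by simp [B]
  have hB_anti {S T : Finset ι} (h : S ⊆ T) : B T ⊆ B S := fun ω hω =>
    memB.2 fun j hj => memB.1 hω j (h hj)
  have key (S : Finset ι) : ∀ i, ((A i ∩ B S).card : ℝ) ≤ 2 * p * (B S).card := by
    induction S using Finset.strongInduction with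
    | H S ih =>
      intro i
      have h1 : ((A i ∩ B (S \ N i)).card : ℝ) ≤ p * (B (S \ N i)).card := by
        convert hA i (S \ N i) Finset.sdiff_disjoint using 3
        ext ω
        simp [memB]
      have h2 : ((A i ∩ B S).card : ℝ) ≤ (A i ∩ B (S \ N i)).card := by
        exact_mod_cast Finset.card_le_card
          (Finset.inter_subset_inter_left (hB_anti Finset.sdiff_subset))
      have h3 : ((B (S \ N i)).card : ℝ) ≤ 2 * (B S).card := by
        by_cases hS : S ∩ N i = ∅
        · rw [Finset.sdiff_eq_self_iff_disjoint.2 (Finset.disjoint_iff_inter_eq_empty.2 hS)]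
          have : (0 : ℝ) ≤ (B S).card := by positivity
          linarith
        have hss : S \ N i ⊂ S := by
          refine Finset.ssubset_iff_subset_ne.2 ⟨Finset.sdiff_subset, fun h => hS ?_⟩
          exact Finset.disjoint_iff_inter_eq_empty.1 (Finset.sdiff_eq_self_iff_disjoint.1 h)
        have hcover : B (S \ N i) ⊆ B S ∪ (N i).biUnion fun j => A j ∩ B (S \ N i) := by
          intro ω hω
          by_cases h : ∃ j ∈ N i, ω ∈ A j
          · obtain ⟨j, hj, hωj⟩ := h
            exact Finset.mem_union_right _
              (Finset.mem_biUnion.2 ⟨j, hj, Finset.mem_inter.2 ⟨hωj, hω⟩⟩)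
          · refine Finset.mem_union_left _ (memB.2 fun j hj hωj => ?_)
            by_cases hjN : j ∈ N i
            · exact h ⟨j, hjN, hωj⟩
            · exact memB.1 hω j (Finset.mem_sdiff.2 ⟨hj, hjN⟩) hωj
        have hcard : ((B (S \ N i)).card : ℝ) ≤
            (B S).card + ∑ j ∈ N i, ((A j ∩ B (S \ N i)).card : ℝ) := by
          exact_mod_cast (Finset.card_le_card hcover).trans ((Finset.card_union_le _ _).trans
            (Nat.add_le_add_left Finset.card_biUnion_le _))
        have hsum : ∑ j ∈ N i, ((A j ∩ B (S \ N i)).card : ℝ) ≤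
            d * (2 * p * (B (S \ N i)).card) := by
          refine (Finset.sum_le_card_nsmul _ _ _ fun j _ => ih _ hss j).trans ?_
          rw [nsmul_eq_mul]
          gcongr
          exact_mod_cast hN i
        have hb : (0 : ℝ) ≤ (B (S \ N i)).card := by positivity
        nlinarith [mul_le_mul_of_nonneg_right hpd hb]
      calc ((A i ∩ B S).card : ℝ) ≤ p * (B (S \ N i)).card := h2.trans h1
        _ ≤ p * (2 * (B S).card) := by gcongr
        _ = _ := by ring
  have hpos (S : Finset ι) : 0 < (B S).card := by
    induction S using Finset.induction_on with
    | empty => exact Finset.card_pos.2 ⟨Classical.arbitrary Ω, by simp [B]⟩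
    | insert i S _ ih =>
      have hsplit : B S ⊆ B (insert i S) ∪ (A i ∩ B S) := by
        intro ω hω
        by_cases h : ω ∈ A i
        · exact Finset.mem_union_right _ (Finset.mem_inter.2 ⟨h, hω⟩)
        · refine Finset.mem_union_left _ (memB.2 fun j hj => ?_)
          rcases Finset.mem_insert.1 hj with rfl | hj
          · exact h
          · exact memB.1 hω j hj
      have h1 : ((B S).card : ℝ) ≤ (B (insert i S)).card + (A i ∩ B S).card := by
        exact_mod_cast (Finset.card_le_card hsplit).trans (Finset.card_union_le _ _)
      have h2 := key S i
      have hd' : (1 : ℝ) ≤ d := by exact_mod_cast hd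
      have h3 : 4 * p ≤ 1 := by nlinarith
      have ih' : (0 : ℝ) < (B S).card := by exact_mod_cast ih
      have : (0 : ℝ) < (B (insert i S)).card := by nlinarith
      exact_mod_cast this
  obtain ⟨ω, hω⟩ := Finset.card_pos.1 (hpos Finset.univ)
  exact ⟨ω, fun i => memB.1 hω i (Finset.mem_univ i)⟩

/-- Events depending on disjoint sets of coordinates are independent. -/
theorem card_inter_mul_card_le {V β : Type*} [Fintype V] [DecidableEq V] [Fintype β]
    [DecidableEq β] (D : Finset V) (A B : Finset (V → β))
    (hA : ∀ f g : V → β, (∀ v ∈ D, f v = g v) → f ∈ A → g ∈ A)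
    (hB : ∀ f g : V → β, (∀ v ∉ D, f v = g v) → f ∈ B → g ∈ B) :
    (A ∩ B).card * Fintype.card (V → β) ≤ A.card * B.card := by
  rw [← Finset.card_univ, ← Finset.card_product, ← Finset.card_product]
  refine Finset.card_le_card_of_injOn
    (fun q => (D.piecewise q.1 q.2, D.piecewise q.2 q.1)) ?_ ?_
  · rintro ⟨f, g⟩ h
    simp only [Finset.coe_product, Set.mem_prod, Finset.mem_coe, Finset.mem_inter] at h ⊢
    exact ⟨hA f _ (fun v hv => by simp [hv]) h.1.1, hB f _ (fun v hv => by simp [hv]) h.1.2⟩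
  · rintro ⟨f, g⟩ - ⟨f', g'⟩ - h
    simp only [Prod.mk.injEq] at h ⊢
    constructor <;> ext v
    · by_cases hv : v ∈ D
      · simpa [hv] using congrFun h.1 v
      · simpa [hv] using congrFun h.2 v
    · by_cases hv : v ∈ D
      · simpa [hv] using congrFun h.2 v
      · simpa [hv] using congrFun h.1 v

theorem card_forall_mem_mul {V β : Type*} [Fintype V] [DecidableEq V] [Fintype β]
    [DecidableEq β] (D : Finset V) (R : Finset β) :
    ({f | ∀ v ∈ D, f v ∈ R} : Finset (V → β)).card * Fintype.card β ^ D.card =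
      R.card ^ D.card * Fintype.card (V → β) := by
  have h : ({f | ∀ v ∈ D, f v ∈ R} : Finset (V → β)) =
      Fintype.piFinset fun v => if v ∈ D then R else Finset.univ := by
    ext f
    simp only [Finset.mem_filter, Finset.mem_univ, true_and, Fintype.mem_piFinset]
    exact forall_congr' fun v => by by_cases hv : v ∈ D <;> simp [hv]
  rw [h, Fintype.card_piFinset, Fintype.card_fun, ← Finset.card_add_card_compl D, pow_add]
  simp only [apply_ite Finset.card, Finset.prod_ite, Finset.prod_const, Finset.card_univ]
  have h1 : ({v | v ∈ D} : Finset V) = D := by simp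
  have h2 : ({v | v ∉ D} : Finset V) = Dᶜ := by ext; simp
  rw [h1, h2]
  ring

theorem SimpleGraph.exists_proper_on_of_card_lt {V : Type*} [Fintype V] [DecidableEq V]
    (G : SimpleGraph V) [DecidableRel G.Adj] {s : ℕ} (T : Finset V)
    (hT : ∀ v ∈ T, (G.neighborFinset v ∩ T).card < s) :
    ∃ c : V → ℕ, ∀ u ∈ T, c u < s ∧ ∀ v ∈ T, G.Adj u v → c u ≠ c v := by
  induction T using Finset.induction_on with
  | empty => exact ⟨fun _ => 0, by simp⟩
  | insert a T ha ih =>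
    obtain ⟨c, hc⟩ := ih fun v hv => (Finset.card_le_card
      (Finset.inter_subset_inter_left (Finset.subset_insert a T))).trans_lt
        (hT v (Finset.mem_insert_of_mem hv))
    obtain ⟨x, hx, hxc⟩ := Finset.exists_mem_notMem_of_card_lt_card
      (s := (G.neighborFinset a ∩ insert a T).image c) (t := Finset.range s)
      (by simpa using Finset.card_image_le.trans_lt (hT a (Finset.mem_insert_self a T)))
    have hx' (v : V) (hv : v ∈ T) (hav : G.Adj a v) : c v ≠ x := fun h =>
      hxc (Finset.mem_image.2 ⟨v, by simp [hav, hv], h⟩)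
    refine ⟨Function.update c a x, fun u hu => ?_⟩
    rcases Finset.mem_insert.1 hu with rfl | hu
    · refine ⟨by simpa using hx, fun v hv huv => ?_⟩
      rw [Function.update_self, Function.update_of_ne huv.ne']
      exact (hx' v ((Finset.mem_insert.1 hv).resolve_left huv.ne') huv).symm
    · have hua : u ≠ a := fun h => ha (h ▸ hu)
      rw [Function.update_of_ne hua]
      refine ⟨(hc u hu).1, fun v hv huv => ?_⟩
      by_cases hva : v = a
      · rw [hva] at huv ⊢
        rw [Function.update_self]
        exact hx' u hu huv.symm
      · rw [Function.update_of_ne hva]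
        exact (hc u hu).2 v ((Finset.mem_insert.1 hv).resolve_left hva) huv

theorem SimpleGraph.exists_sparse_total_dominating {V : Type*} [Fintype V] [DecidableEq V]
    (G : SimpleGraph V) [DecidableRel G.Adj] {k m s : ℕ} (hG : G.IsRegularOfDegree k)
    (hk : 0 < k) (hm : 0 < m)
    (h : 4 * ((1 - 1 / m : ℝ) ^ k + k.choose s / (m : ℝ) ^ s) * (k * k : ℕ) ≤ 1) :
    ∃ T : Finset V, ∀ v,
      (G.neighborFinset v ∩ T).Nonempty ∧ (G.neighborFinset v ∩ T).card < s := by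
  have : NeZero m := ⟨hm.ne'⟩
  have hm' : (0 : ℝ) < m := by exact_mod_cast hm
  have hm1 : (1 : ℝ) ≤ m := by exact_mod_cast hm
  let T (f : V → Fin m) : Finset V := {u | f u = 0}
  let A (v : V) : Finset (V → Fin m) :=
    {f | ¬((G.neighborFinset v ∩ T f).Nonempty ∧ (G.neighborFinset v ∩ T f).card < s)}
  let N (v : V) : Finset V := {u | ¬ Disjoint (G.neighborFinset u) (G.neighborFinset v)}
  have hcardN (v : V) : (G.neighborFinset v).card = k := by
    rw [card_neighborFinset_eq_degree, hG v]
  set p : ℝ := (1 - 1 / m : ℝ) ^ k + k.choose s / (m : ℝ) ^ s with hp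
  have hsub : (0 : ℝ) ≤ 1 - 1 / m := by
    rw [sub_nonneg, div_le_one hm']
    exact hm1
  have hAcongr (v : V) (f g : V → Fin m) (hfg : ∀ u ∈ G.neighborFinset v, f u = g u)
      (hf : f ∈ A v) : g ∈ A v := by
    have : G.neighborFinset v ∩ T f = G.neighborFinset v ∩ T g := by
      ext u
      simp only [Finset.mem_inter, T, Finset.mem_filter, Finset.mem_univ, true_and]
      exact and_congr_right fun hu => by rw [hfg u hu]
    simpa only [A, Finset.mem_filter, Finset.mem_univ, true_and, this] using hf
  have hAcard (v : V) : ((A v).card : ℝ) ≤ p * Fintype.card (V → Fin m) := by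
    have hcover : A v ⊆ ({f | ∀ u ∈ G.neighborFinset v, f u ∈ ({0}ᶜ : Finset (Fin m))} :
          Finset (V → Fin m)) ∪ (Finset.powersetCard s (G.neighborFinset v)).biUnion fun S =>
            ({f | ∀ u ∈ S, f u ∈ ({0} : Finset (Fin m))} : Finset (V → Fin m)) := by
      intro f hf
      simp only [A, Finset.mem_filter, Finset.mem_univ, true_and, not_and_or,
        Finset.not_nonempty_iff_eq_empty, not_lt] at hf
      rcases hf with hf | hf
      · refine Finset.mem_union_left _ (Finset.mem_filter.2 ⟨Finset.mem_univ _, fun u hu => ?_⟩)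
        rw [Finset.mem_compl, Finset.mem_singleton]
        intro hfu
        have : u ∈ G.neighborFinset v ∩ T f := Finset.mem_inter.2 ⟨hu, by simp [T, hfu]⟩
        simp [hf] at this
      · obtain ⟨S, hS, hSc⟩ := Finset.exists_subset_card_eq hf
        refine Finset.mem_union_right _ (Finset.mem_biUnion.2 ⟨S, Finset.mem_powersetCard.2
          ⟨hS.trans Finset.inter_subset_left, hSc⟩, Finset.mem_filter.2
            ⟨Finset.mem_univ _, fun u hu => ?_⟩⟩)
        have := (Finset.mem_inter.1 (hS hu)).2
        simpa [T] using this
    have h1 : (({f | ∀ u ∈ G.neighborFinset v, f u ∈ ({0}ᶜ : Finset (Fin m))} :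
        Finset (V → Fin m)).card : ℝ) = (1 - 1 / m : ℝ) ^ k * Fintype.card (V → Fin m) := by
      have h := card_forall_mem_mul (G.neighborFinset v) ({0}ᶜ : Finset (Fin m))
      rw [hcardN, Finset.card_compl, Finset.card_singleton, Fintype.card_fin] at h
      have h' := congrArg (Nat.cast (R := ℝ)) h
      push_cast [Nat.cast_sub hm] at h'
      have : (1 - 1 / m : ℝ) = (m - 1) / m := by field_simp
      rw [this, div_pow, div_mul_eq_mul_div, eq_div_iff (by positivity)]
      exact h'
    have h2 (S : Finset V) (hS : S ∈ Finset.powersetCard s (G.neighborFinset v)) :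
        (({f | ∀ u ∈ S, f u ∈ ({0} : Finset (Fin m))} : Finset (V → Fin m)).card : ℝ) ≤
          1 / (m : ℝ) ^ s * Fintype.card (V → Fin m) := by
      have h := card_forall_mem_mul S ({0} : Finset (Fin m))
      rw [(Finset.mem_powersetCard.1 hS).2, Finset.card_singleton, Fintype.card_fin, one_pow,
        one_mul] at h
      have h' := congrArg (Nat.cast (R := ℝ)) h
      rw [div_mul_eq_mul_div, le_div_iff₀ (by positivity), one_mul, ← h']
      push_cast
      rfl
    have h3 : ((A v).card : ℝ) ≤ (({f | ∀ u ∈ G.neighborFinset v, f u ∈ ({0}ᶜ : Finset (Fin m))} :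
        Finset (V → Fin m)).card : ℝ) + ∑ S ∈ Finset.powersetCard s (G.neighborFinset v),
        (({f | ∀ u ∈ S, f u ∈ ({0} : Finset (Fin m))} : Finset (V → Fin m)).card : ℝ) := by
      exact_mod_cast (Finset.card_le_card hcover).trans ((Finset.card_union_le _ _).trans
        (Nat.add_le_add_left Finset.card_biUnion_le _))
    have h4 := Finset.sum_le_card_nsmul _ _ _ h2
    rw [h1] at h3
    rw [Finset.card_powersetCard, hcardN, nsmul_eq_mul] at h4
    refine h3.trans ((add_le_add_right h4 _).trans (le_of_eq ?_))
    rw [hp]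
    ring
  have hNcard (v : V) : (N v).card ≤ k * k := by
    refine (Finset.card_le_card (t := (G.neighborFinset v).biUnion fun x => G.neighborFinset x)
      fun u hu => ?_).trans ((Finset.card_biUnion_le_card_mul _ _ k
        fun x _ => (hcardN x).le).trans (by rw [hcardN]))
    obtain ⟨x, hxu, hxv⟩ := Finset.not_disjoint_iff.1 (Finset.mem_filter.1 hu).2
    exact Finset.mem_biUnion.2 ⟨x, hxv, by simpa [G.adj_comm] using hxu⟩
  have hdep (v : V) (S : Finset V) (hS : Disjoint S (N v)) :
      (({f ∈ A v | ∀ j ∈ S, f ∉ A j} : Finset (V → Fin m)).card : ℝ) ≤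
        p * ({f | ∀ j ∈ S, f ∉ A j} : Finset (V → Fin m)).card := by
    have hind := card_inter_mul_card_le (G.neighborFinset v) (A v)
      ({f | ∀ j ∈ S, f ∉ A j} : Finset (V → Fin m)) (hAcongr v) fun f g hfg hf => by
        refine Finset.mem_filter.2 ⟨Finset.mem_univ _, fun j hj hgj => ?_⟩
        refine (Finset.mem_filter.1 hf).2 j hj (hAcongr j g f (fun u hu => ?_) hgj)
        refine (hfg u fun huv => ?_).symm
        exact Finset.disjoint_left.1 hS hj (Finset.mem_filter.2
          ⟨Finset.mem_univ _, Finset.not_disjoint_iff.2 ⟨u, hu, huv⟩⟩)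
    have heq : ({f ∈ A v | ∀ j ∈ S, f ∉ A j} : Finset (V → Fin m)) =
        A v ∩ ({f | ∀ j ∈ S, f ∉ A j} : Finset (V → Fin m)) := by
      ext
      simp
    rw [heq]
    have hΩ : (0 : ℝ) < Fintype.card (V → Fin m) := by exact_mod_cast Fintype.card_pos
    refine le_of_mul_le_mul_right ?_ hΩ
    calc _ ≤ ((A v).card : ℝ) * ({f | ∀ j ∈ S, f ∉ A j} : Finset (V → Fin m)).card := by
          exact_mod_cast hind
      _ ≤ (p * Fintype.card (V → Fin m)) *
          ({f | ∀ j ∈ S, f ∉ A j} : Finset (V → Fin m)).card := by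
          gcongr
          exact hAcard v
      _ = _ := by ring
  have hp0 : 0 ≤ p := add_nonneg (pow_nonneg hsub k) (by positivity)
  obtain ⟨f, hf⟩ := exists_forall_notMem_of_local A N hp0 (d := k * k) (by positivity)
    hNcard h hdep
  refine ⟨T f, fun v => ?_⟩
  have hfv := hf v
  simp only [A, Finset.mem_filter, Finset.mem_univ, true_and, not_not] at hfv
  exact hfv

theorem choose_div_pow_le {k m L s : ℕ} (hm : 0 < m) (hs : s = 48 * L) (hk : k ≤ 8 * L * m) :
    (k.choose s : ℝ) / (m : ℝ) ^ s ≤ (1 / 16) ^ L := by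
  have hm' : (0 : ℝ) < m := by exact_mod_cast hm
  have hk' : (k : ℝ) ≤ (s / 6 : ℝ) * m := by
    have : (k : ℝ) ≤ 8 * L * m := by exact_mod_cast hk
    rw [hs]
    push_cast
    linarith
  calc (k.choose s : ℝ) / (m : ℝ) ^ s ≤ ((k : ℝ) ^ s / s.factorial) / (m : ℝ) ^ s := by
        gcongr
        exact Nat.choose_le_pow_div s k
    _ ≤ (((s / 6 : ℝ) * m) ^ s / s.factorial) / (m : ℝ) ^ s := by gcongr
    _ = (1 / 6) ^ s * ((s : ℝ) ^ s / s.factorial) := by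
        rw [mul_pow, div_pow, one_div, inv_pow]
        field_simp
    _ ≤ (1 / 6) ^ s * Real.exp s := by
        gcongr
        exact Real.pow_div_factorial_le_exp _ (by positivity) _
    _ = (1 / 6 * Real.exp 1) ^ s := by rw [mul_pow, ← Real.exp_nat_mul, mul_one]
    _ ≤ (1 / 2) ^ s := by
        gcongr
        linarith [Real.exp_one_lt_three]
    _ ≤ (1 / 2) ^ (4 * L) := pow_le_pow_of_le_one (by norm_num) (by norm_num) (by omega)
    _ = (1 / 16) ^ L := by rw [pow_mul]; norm_num

theorem one_sub_inv_pow_le {k m L : ℕ} (hm : 0 < m) (hk : m * (4 * L) ≤ k) :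
    (1 - 1 / m : ℝ) ^ k ≤ (1 / 16) ^ L := by
  have hm' : (0 : ℝ) < m := by exact_mod_cast hm
  have hm1 : (1 : ℝ) / m ≤ 1 := (div_le_one hm').2 (by exact_mod_cast hm)
  have h2 : Real.exp (-1) ≤ 1 / 2 := by
    rw [Real.exp_neg, one_div]
    exact inv_anti₀ (by norm_num) Real.exp_one_gt_two.le
  calc (1 - 1 / m : ℝ) ^ k ≤ (1 - 1 / m : ℝ) ^ (m * (4 * L)) :=
        pow_le_pow_of_le_one (by linarith) (by linarith [one_div_pos.2 hm']) hk
    _ ≤ (Real.exp (-(1 / m))) ^ (m * (4 * L)) := by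
        gcongr
        exact Real.one_sub_le_exp_neg _
    _ = (Real.exp (-1)) ^ (4 * L) := by
        rw [pow_mul, ← Real.exp_nat_mul]
        congr 2
        field_simp
    _ ≤ (1 / 2) ^ (4 * L) := by gcongr
    _ = (1 / 16) ^ L := by rw [pow_mul]; norm_num

theorem forty_eight_mul_le_two_pow {L : ℕ} (hL : 10 ≤ L) : 48 * L ≤ 2 ^ (L - 1) := by
  induction L, hL using Nat.le_induction with
  | base => norm_num
  | succ n hn ih =>
    obtain ⟨j, rfl⟩ : ∃ j, n = j + 1 := ⟨n - 1, by omega⟩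
    simp only [Nat.add_sub_cancel] at ih ⊢
    rw [pow_succ]
    omega

theorem SimpleGraph.exists_dynamic_add_log {V : Type*} [Fintype V] [DecidableEq V]
    (G : SimpleGraph V) [DecidableRel G.Adj] {k n : ℕ} (hG : G.IsRegularOfDegree k)
    (hk : 512 ≤ k) (hn : G.Colorable n) :
    ∃ g : V → Fin (n + 48 * (Nat.log 2 k + 1)),
      ∀ v, (∀ u, G.Adj v u → g v ≠ g u) ∧ G.SplitsNeighbors g v := by
  set L := Nat.log 2 k + 1 with hL
  have hL10 : 10 ≤ L := by
    have : 9 ≤ Nat.log 2 k := (Nat.le_log_iff_pow_le (by norm_num) (by omega)).2 (by omega)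
    omega
  have hkL : k < 2 ^ L := Nat.lt_pow_succ_log_self (by norm_num) k
  have hsk : 48 * L ≤ k :=
    (forty_eight_mul_le_two_pow hL10).trans (Nat.pow_log_le_self 2 (by omega))
  set m := k / (4 * L) with hm
  have hmpos : 0 < m := Nat.div_pos (by omega) (by omega)
  have hmk : m * (4 * L) ≤ k := Nat.div_mul_le_self _ _
  have hkm : k ≤ 8 * L * m := by
    have h1 : k < (m + 1) * (4 * L) := Nat.lt_mul_of_div_lt (Nat.lt_succ_self _) (by omega)
    nlinarith
  obtain ⟨T, hT⟩ := G.exists_sparse_total_dominating hG (s := 48 * L) (by omega) hmpos (by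
    have h1 := one_sub_inv_pow_le hmpos hmk
    have h2 := choose_div_pow_le hmpos rfl hkm
    have h3 : ((k * k : ℕ) : ℝ) ≤ 4 ^ L := by
      have : k * k ≤ 4 ^ L := by
        calc k * k ≤ 2 ^ L * 2 ^ L := Nat.mul_le_mul hkL.le hkL.le
          _ = 4 ^ L := by rw [← mul_pow]; norm_num
      exact_mod_cast this
    calc _ ≤ 4 * ((1 / 16 : ℝ) ^ L + (1 / 16) ^ L) * 4 ^ L := by gcongr
      _ = 8 * (1 / 4) ^ L := by
        have : (1 / 4 : ℝ) ^ L = (1 / 16) ^ L * 4 ^ L := by rw [← mul_pow]; norm_num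
        rw [this]
        ring
      _ ≤ 8 * (1 / 4) ^ 2 := by
        gcongr 8 * ?_
        exact pow_le_pow_of_le_one (by norm_num) (by norm_num) (by omega)
      _ ≤ 1 := by norm_num)
  obtain ⟨c⟩ := hn
  obtain ⟨c', hc'⟩ := G.exists_proper_on_of_card_lt T fun v _ => (hT v).2
  let e : Fin n ⊕ Fin (48 * L) ≃ Fin (n + 48 * L) := finSumFinEquiv
  let g (v : V) : Fin n ⊕ Fin (48 * L) :=
    if h : v ∈ T then Sum.inr ⟨c' v, (hc' v h).1⟩ else Sum.inl (c v)
  refine ⟨fun v => e (g v), fun v => ⟨fun u hu => e.injective.ne ?_, ?_⟩⟩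
  · by_cases hv : v ∈ T <;> by_cases hu' : u ∈ T
    · simpa [g, hv, hu'] using (hc' v hv).2 u hu' hu
    · simp [g, hv, hu']
    · simp [g, hv, hu']
    · simpa [g, hv, hu'] using c.valid hu
  · obtain ⟨a, ha⟩ := (hT v).1
    obtain ⟨haN, haT⟩ := Finset.mem_inter.1 ha
    obtain ⟨b, hbN, hbT⟩ : ∃ b ∈ G.neighborFinset v, b ∉ T := by
      by_contra! hcon
      have h1 := (hT v).2
      rw [Finset.inter_eq_left.2 hcon, card_neighborFinset_eq_degree, hG v] at h1
      omega
    exact ⟨a, b, by simpa using haN, by simpa using hbN,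
      e.injective.ne (by simp [g, haT, hbT])⟩

theorem dynChromNum_le_of_splitsNeighbors {V : Type*} (G : SimpleGraph V) {n : ℕ} (g : V → Fin n)
    (hg : ∀ v, (∀ u, G.Adj v u → g v ≠ g u) ∧ G.SplitsNeighbors g v) : dynChromNum G ≤ n :=
  Nat.sInf_le ⟨g, fun u v huv => (hg u).1 v huv, fun v _ => (hg v).2⟩

/-- There is a constant `c > 0` such that every finite `k`-regular graph `G` satisfies
`χ_d(G) ≤ min {2 χ(G), χ(G) + c ln k + 1}`. -/
theorem dynChromNum_le_min :
    ∃ c : ℝ, 0 < c ∧ ∀ (k : ℕ), 1 ≤ k → ∀ (V : Type) [Fintype V] (G : SimpleGraph V),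
      IsKRegular G k →
        (dynChromNum G : ℝ) ≤
          min (2 * (chromNum G : ℝ)) ((chromNum G : ℝ) + c * Real.log k + 1) := by
  classical
  refine ⟨1000, by norm_num, fun k hk V _ G hG => ?_⟩
  have hreg : G.IsRegularOfDegree k := fun v => by
    rw [← hG v, Set.ncard_eq_toFinset_card', ← card_neighborFinset_eq_degree]
    rfl
  have hcol : G.Colorable (chromNum G) :=
    Nat.sInf_mem (s := {n | G.Colorable n}) ⟨_, G.colorable_of_fintype⟩
  rcases hk.eq_or_lt with rfl | hk
  · have hle : dynChromNum G ≤ chromNum G := by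
      obtain ⟨c⟩ := hcol
      exact Nat.sInf_le ⟨c, fun u v huv => c.valid huv, fun v hv => by
        rw [hG v] at hv
        omega⟩
    have hle' : (dynChromNum G : ℝ) ≤ chromNum G := by exact_mod_cast hle
    have h0 : (0 : ℝ) ≤ chromNum G := by positivity
    refine le_min (by linarith) ?_
    simp only [Nat.cast_one, Real.log_one]
    linarith
  have htwo : dynChromNum G ≤ 2 * chromNum G := by
    obtain ⟨g, hg⟩ := G.exists_dynamic_two_mul hk hreg hcol
    exact dynChromNum_le_of_splitsNeighbors G g hg
  have htwo' : (dynChromNum G : ℝ) ≤ 2 * chromNum G := by exact_mod_cast htwo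
  have hlog : Real.log 2 ≤ Real.log k :=
    Real.log_le_log (by norm_num) (by exact_mod_cast hk)
  have hlog2 := Real.log_two_gt_d9
  refine le_min htwo' ?_
  by_cases hk512 : 512 ≤ k
  · obtain ⟨g, hg⟩ := G.exists_dynamic_add_log hreg hk512 hcol
    have h1 : (dynChromNum G : ℝ) ≤ chromNum G + 48 * (Nat.log 2 k + 1) := by
      exact_mod_cast dynChromNum_le_of_splitsNeighbors G g hg
    have h2 : (Nat.log 2 k : ℝ) * Real.log 2 ≤ Real.log k := by
      rw [← Real.log_pow]
      exact Real.log_le_log (by positivity)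
        (by exact_mod_cast Nat.pow_log_le_self 2 (show k ≠ 0 by omega))
    have h3 : (0 : ℝ) ≤ Nat.log 2 k := by positivity
    nlinarith
  · obtain ⟨c, hc⟩ := G.exists_proper_on_of_card_lt (s := k + 1) Finset.univ fun v _ => by
      simp [hreg v]
    have h1 : chromNum G ≤ k + 1 := Nat.sInf_le ⟨Coloring.mk
      (fun v => (⟨c v, (hc v (Finset.mem_univ v)).1⟩ : Fin (k + 1))) fun {u v} huv => by
        simpa using (hc u (Finset.mem_univ u)).2 v (Finset.mem_univ v) huv⟩
    have h2 : (chromNum G : ℝ) ≤ k + 1 := by exact_mod_cast h1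
    have h3 : (k : ℝ) ≤ 512 := by
      exact_mod_cast (not_le.1 hk512).le
    linarith
end
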